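/- arXiv:2403.07597 — 4 statements merged into one kernel-verified Lean document; each statement's English description precedes it below -/
import Mathlib

section
/- Every 4-strongly-connected semicomplete multipartite digraph has, for every pair of distinct vertices x and y, a spanning (x,y)-generalized path. -/
open Classical

universe u v

/-- A semicomplete multipartite digraph: `A` is the arc relation and `part` assigns to
each vertex its partite set.  There are no arcs inside a partite set and at least one
arc between any two vertices of different partite sets. -/
structure IsSMD {V : Type u} {K : Type v} (A : V → V → Prop) (part : V → K) : Prop where
  noInside : ∀ x y : V, part x = part y → ¬ A x y
  adj : ∀ x y : V, part x ≠ part y → A x y ∨ A y x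

/-- An extended semicomplete digraph: a semicomplete multipartite digraph in which any
two vertices of the same partite set have identical in- and out-neighbourhoods. -/
def IsESD {V : Type u} {K : Type v} (A : V → V → Prop) (part : V → K) : Prop :=
  IsSMD A part ∧ ∀ x y : V, part x = part y →
    (∀ z, A x z ↔ A y z) ∧ (∀ z, A z x ↔ A z y)

/-- A generalized path (G-path): a sequence of distinct vertices in which each
consecutive pair is either an arc or a pair of vertices in the same partite set. -/
structure GPath {V : Type u} {K : Type v} (A : V → V → Prop) (part : V → K) where
  verts : List V
  ne : verts ≠ []
  nodup : verts.Nodup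
  chain : verts.Chain' fun a b => A a b ∨ part a = part b

/-- A generalized cycle (G-cycle): as a G-path, but also the pair consisting of the
last and the first vertex is an arc or lies in one partite set. -/
structure GCycle {V : Type u} {K : Type v} (A : V → V → Prop) (part : V → K)
    extends GPath A part where
  close : A (verts.getLast ne) (verts.head ne) ∨
    part (verts.getLast ne) = part (verts.head ne)

variable {V : Type u} {K : Type v} {A : V → V → Prop} {part : V → K}

/-- The length of a G-path: the number of arcs it uses. -/
noncomputable def GPath.len (P : GPath A part) : ℕ :=
  (P.verts.zip P.verts.tail).countP fun q => decide (A q.1 q.2)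

/-- The length of a G-cycle: the number of arcs it uses (cyclically). -/
noncomputable def GCycle.len (C : GCycle A part) : ℕ :=
  (C.toGPath.verts.zip (C.toGPath.verts.rotate 1)).countP fun q => decide (A q.1 q.2)

/-- `x` and `y` are (cyclically) consecutive on the G-cycle `C`, `y` following `x`. -/
def GCycle.consec (C : GCycle A part) (x y : V) : Prop :=
  (x, y) ∈ C.toGPath.verts.zip (C.toGPath.verts.rotate 1)

/-- The pair `(x, y)` (an `(x,y)`-G-path) has a partner on the G-cycle `C`:
there are consecutive vertices `w, w'` of `C` with `w → x` and `y → w'`. -/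
def GCycle.partner (C : GCycle A part) (x y : V) : Prop :=
  ∃ w w' : V, C.consec w w' ∧ A w x ∧ A y w'

/-- `v` is out-singular with respect to `C` (that is, `v ⇒ C`). -/
def GCycle.OutSingular (C : GCycle A part) (v : V) : Prop :=
  ∀ w ∈ C.toGPath.verts, (part v ≠ part w → A v w) ∧ ¬ A w v

/-- `v` is in-singular with respect to `C` (that is, `C ⇒ v`). -/
def GCycle.InSingular (C : GCycle A part) (v : V) : Prop :=
  ∀ w ∈ C.toGPath.verts, (part v ≠ part w → A w v) ∧ ¬ A v w

/-- `v` is singular with respect to `C`. -/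
def GCycle.SingularWrt (C : GCycle A part) (v : V) : Prop :=
  C.OutSingular v ∨ C.InSingular v

/-- `C₁ ≃> C₂`: `C₁` has singular vertices w.r.t. `C₂`, all of which are out-singular,
and `C₂` has singular vertices w.r.t. `C₁`, all of which are in-singular. -/
def SimGt (C₁ C₂ : GCycle A part) : Prop :=
  (∃ v ∈ C₁.toGPath.verts, C₂.SingularWrt v) ∧
  (∀ v ∈ C₁.toGPath.verts, C₂.SingularWrt v → C₂.OutSingular v) ∧
  (∃ v ∈ C₂.toGPath.verts, C₁.SingularWrt v) ∧
  (∀ v ∈ C₂.toGPath.verts, C₁.SingularWrt v → C₁.InSingular v)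

/-- A G-cycle subdigraph: a collection of pairwise vertex-disjoint G-cycles. -/
structure GCSub {V' : Type u} {K' : Type v} (A' : V' → V' → Prop) (part' : V' → K') where
  cycles : List (GCycle A' part')
  disj : cycles.Pairwise fun C C' => ∀ x ∈ C.toGPath.verts, x ∉ C'.toGPath.verts

/-- The total number of arcs used by a G-cycle subdigraph. -/
noncomputable def GCSub.arcs (F : GCSub A part) : ℕ :=
  (F.cycles.map GCycle.len).sum

/-- A G-cycle factor: a G-cycle subdigraph covering all vertices. -/
def GCSub.IsFactor (F : GCSub A part) : Prop :=
  ∀ v : V, ∃ C ∈ F.cycles, v ∈ C.toGPath.verts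

/-- Strong connectivity of a digraph. -/
def IsStrong (A : V → V → Prop) : Prop :=
  ∀ x y : V, Relation.ReflTransGen A x y

/-- Strong connectivity after deleting the vertex set `X`. -/
def IsStrongOutside (A : V → V → Prop) (X : Set V) : Prop :=
  ∀ x y : V, x ∉ X → y ∉ X →
    Relation.ReflTransGen (fun a b => A a b ∧ a ∉ X ∧ b ∉ X) x y

/-- `k`-strong connectivity. -/
def KStrong [Fintype V] (A : V → V → Prop) (k : ℕ) : Prop :=
  k + 1 ≤ Fintype.card V ∧
    ∀ X : Finset V, X.card ≤ k - 1 → IsStrongOutside A (↑X : Set V)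

/-- A nonempty list of vertices forming an `r`-chain which starts in `S` and ends in `R`. -/
def IsLinkingPath {α : Type*} (r : α → α → Prop) (S R : α → Prop) (l : List α) : Prop :=
  l ≠ [] ∧ l.IsChain r ∧ (∀ a ∈ l.head?, S a) ∧ ∀ b ∈ l.getLast?, R b

/-! ### Linkings in finite digraphs -/

/-- If `f` eventually maps `u` into the right summand, the orbit of `u` before that moment
is a list of elements of the left summand. -/
theorem exists_orbit_list {α β : Type*} (f : α ⊕ β → α ⊕ β) (n : ℕ) :
    ∀ (u : α ⊕ β) (j : β), f^[n + 1] u = Sum.inr j →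
      ∃ (l : List α) (i : β),
        (u :: (l.map Sum.inl ++ [Sum.inr i])).IsChain (fun a b => f a = b) := by
  induction n with
  | zero => exact fun u j h => ⟨[], j, by simpa using h⟩
  | succ n ih =>
    intro u j h
    rcases hu : f u with v | i
    · rw [Function.iterate_succ_apply, hu] at h
      obtain ⟨l, i, hl⟩ := ih _ _ h
      exact ⟨v :: l, i, by simpa [hu] using hl⟩
    · exact ⟨[], i, by simpa using hu⟩

/-- `v` is the image of `inr i` under `n + 1` steps of `f`, all intermediate points lying in the
left summand. -/
inductive OrbitReach {α β : Type*} (f : α ⊕ β → α ⊕ β) (i : β) : ℕ → α → Prop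
  | base {v : α} : f (Sum.inr i) = Sum.inl v → OrbitReach f i 0 v
  | step {n : ℕ} {u v : α} : OrbitReach f i n u → f (Sum.inl u) = Sum.inl v →
      OrbitReach f i (n + 1) v

theorem OrbitReach.unique {α β : Type*} {f : α ⊕ β → α ⊕ β} (hf : Function.Injective f)
    {i i' : β} {n n' : ℕ} {v : α} (h : OrbitReach f i n v) (h' : OrbitReach f i' n' v) :
    i = i' ∧ n = n' := by
  induction h generalizing n' with
  | base hv =>
    cases h' with
    | base hv' => exact ⟨Sum.inr_injective (hf (hv.trans hv'.symm)), rfl⟩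
    | step _ hv' => exact absurd (hf (hv.trans hv'.symm)) (by simp)
  | step _ hv ih =>
    cases h' with
    | base hv' => exact absurd (hf (hv.trans hv'.symm)) (by simp)
    | step h1 hv' =>
      obtain rfl := Sum.inl_injective (hf (hv.trans hv'.symm))
      obtain ⟨rfl, rfl⟩ := ih h1
      exact ⟨rfl, rfl⟩

theorem OrbitReach.list {α β : Type*} {f : α ⊕ β → α ⊕ β} (hf : Function.Injective f)
    {i j : β} (l : List α) : ∀ (n : ℕ) (u : α), OrbitReach f i n u →
      (Sum.inl u :: (l.map Sum.inl ++ [Sum.inr j])).IsChain (fun a b => f a = b) →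
      (∀ v ∈ l, ∃ m, n < m ∧ OrbitReach f i m v) ∧ (u :: l).Nodup := by
  induction l with
  | nil => simp
  | cons a l ih =>
    intro n u hu hl
    simp only [List.map_cons, List.cons_append, List.isChain_cons_cons] at hl
    have ha : OrbitReach f i (n + 1) a := .step hu hl.1
    obtain ⟨h1, h2⟩ := ih _ _ ha hl.2
    have h3 : ∀ v ∈ a :: l, ∃ m, n < m ∧ OrbitReach f i m v := by
      intro v hv
      rcases List.mem_cons.1 hv with rfl | hv
      · exact ⟨n + 1, by omega, ha⟩
      · obtain ⟨m, hm, h⟩ := h1 v hv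
        exact ⟨m, by omega, h⟩
    refine ⟨h3, List.nodup_cons.2 ⟨fun h => ?_, h2⟩⟩
    obtain ⟨m, hm, h⟩ := h3 u h
    exact absurd (hu.unique hf h).2 (by omega)

/-- A form of Menger's theorem: if every set separating `S` from `R` has at least `k` elements,
there are `k` disjoint paths from `S` to `R`. -/
theorem exists_linking_paths {α : Type*} [Fintype α] {r : α → α → Prop} (hr : ∀ a, r a a)
    (S R : α → Prop) (k : ℕ)
    (hcut : ∀ Z X : Finset α, (∀ z ∈ Z, ¬ R z) → (∀ s, S s → s ∈ Z ∨ s ∈ X) →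
      (∀ z ∈ Z, ∀ w, r z w → w ∈ Z ∨ w ∈ X) → k ≤ X.card) :
    ∃ F : List (List α), F.length = k ∧ (∀ P ∈ F, IsLinkingPath r S R P) ∧ F.flatten.Nodup := by
  let rel : α ⊕ Fin k → α ⊕ Fin k → Prop
    | .inl u, .inl v => r u v
    | .inl u, .inr _ => R u
    | .inr _, .inl v => S v
    | .inr _, .inr _ => False
  obtain ⟨f, hf, hrel⟩ : ∃ f : α ⊕ Fin k → α ⊕ Fin k, f.Injective ∧ ∀ a, rel a (f a) := by
    rw [← Fintype.all_card_le_filter_rel_iff_exists_injective]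
    intro B
    rw [← Finset.card_toLeft_add_card_toRight (u := B)]
    set N : Finset (α ⊕ Fin k) := {b | ∃ a ∈ B, rel a b} with hN
    have hmem : ∀ b, b ∈ N ↔ ∃ a ∈ B, rel a b := by simp [hN]
    rw [← Finset.card_toLeft_add_card_toRight (u := N)]
    have hsub : B.toLeft ⊆ N.toLeft := fun a ha => by
      rw [Finset.mem_toLeft] at ha ⊢
      exact (hmem _).2 ⟨_, ha, hr a⟩
    have hk : B.toRight.card ≤ k := by simpa using Finset.card_le_univ B.toRight
    rcases B.toRight.eq_empty_or_nonempty with h0 | ⟨j, hj⟩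
    · have := Finset.card_le_card hsub
      simp only [h0, Finset.card_empty]
      omega
    rw [Finset.mem_toRight] at hj
    by_cases hZ : ∃ z ∈ B.toLeft, R z
    · obtain ⟨z, hz, hRz⟩ := hZ
      rw [Finset.mem_toLeft] at hz
      have : N.toRight = Finset.univ := by
        ext i
        simp only [Finset.mem_toRight, Finset.mem_univ, iff_true]
        exact (hmem _).2 ⟨_, hz, hRz⟩
      have h1 := Finset.card_le_card hsub
      rw [this, Finset.card_univ, Fintype.card_fin]
      omega
    · push Not at hZ
      have h1 := hcut B.toLeft (N.toLeft \ B.toLeft) hZ (fun s hs => by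
        have : Sum.inl s ∈ N := (hmem _).2 ⟨_, hj, hs⟩
        simp [this, Classical.em]) (fun z hz w hw => by
        rw [Finset.mem_toLeft] at hz
        have : Sum.inl w ∈ N := (hmem _).2 ⟨_, hz, hw⟩
        simp [this, Classical.em])
      have h2 := Finset.card_sdiff_add_card_eq_card hsub
      omega
  have horb : ∀ i : Fin k, ∃ (u : α) (l : List α) (j : Fin k), f (Sum.inr i) = Sum.inl u ∧
      (Sum.inl u :: (l.map Sum.inl ++ [Sum.inr j])).IsChain (fun a b => f a = b) := by
    intro i
    obtain ⟨n, hn, hper⟩ := hf.mem_periodicPts (Sum.inr i)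
    obtain ⟨n, rfl⟩ := Nat.exists_eq_add_of_lt hn
    obtain ⟨l, j, hl⟩ := exists_orbit_list f (0 + n) (Sum.inr i) i hper
    have hi := hrel (Sum.inr i)
    cases l with
    | nil =>
      have : f (Sum.inr i) = Sum.inr j := by simpa using hl
      rw [this] at hi
      exact hi.elim
    | cons u l =>
      simp only [List.map_cons, List.cons_append, List.isChain_cons_cons] at hl
      exact ⟨u, l, j, hl⟩
  choose u l j hu hl using horb
  have hreach : ∀ i, ∀ v ∈ u i :: l i, ∃ m, OrbitReach f i m v := by
    intro i v hv
    rcases List.mem_cons.1 hv with rfl | hv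
    · exact ⟨0, .base (hu i)⟩
    · obtain ⟨m, _, h⟩ := (OrbitReach.list hf (l i) 0 (u i) (.base (hu i)) (hl i)).1 v hv
      exact ⟨m, h⟩
  refine ⟨(List.finRange k).map fun i => u i :: l i, by simp, ?_, ?_⟩
  · intro P hP
    obtain ⟨i, _, rfl⟩ := List.mem_map.1 hP
    have h1 : ((u i :: l i).map Sum.inl ++ [Sum.inr (j i)]).IsChain (fun a b => f a = b) := by
      simpa using hl i
    rw [List.isChain_append, List.isChain_map] at h1
    refine ⟨by simp, h1.1.imp fun a b hab => ?_, ?_, ?_⟩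
    · simpa [hab, rel] using hrel (Sum.inl a)
    · simpa [hu, rel] using hrel (Sum.inr i)
    · intro b hb
      have h2 : f (Sum.inl b) = Sum.inr (j i) :=
        h1.2.2 (Sum.inl b) (by rw [List.getLast?_map, hb]; rfl) _ (by simp)
      simpa [h2, rel] using hrel (Sum.inl b)
  · rw [List.nodup_flatten]
    constructor
    · intro P hP
      obtain ⟨i, _, rfl⟩ := List.mem_map.1 hP
      exact (OrbitReach.list hf (l i) 0 (u i) (.base (hu i)) (hl i)).2
    · rw [List.pairwise_map]
      refine (List.nodup_finRange k).imp fun {i i'} hne v hv hv' => ?_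
      obtain ⟨m, hm⟩ := hreach i v hv
      obtain ⟨m', hm'⟩ := hreach i' v hv'
      exact hne (hm.unique hf hm').1

/-! ### Merging paths -/

theorem exists_chain_merge {α : Type*} {r : α → α → Prop} (tot : ∀ a b, r a b ∨ r b a)
    {R : α → Prop} (n : ℕ) : ∀ (p q : α) (s t : List α), s.length + t.length = n →
      (p :: s).IsChain r → (q :: t).IsChain r →
      (∀ b ∈ (p :: s).getLast?, R b) → (∀ b ∈ (q :: t).getLast?, R b) →
      ∃ h m, (h = p ∨ h = q) ∧ (h :: m).IsChain r ∧ (∀ b ∈ (h :: m).getLast?, R b) ∧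
        (h :: m).Perm (p :: s ++ q :: t) := by
  induction n using Nat.strong_induction_on with
  | _ n ih =>
  have key : ∀ (p q : α) (s t : List α), s.length + t.length = n → r p q →
      (p :: s).IsChain r → (q :: t).IsChain r →
      (∀ b ∈ (p :: s).getLast?, R b) → (∀ b ∈ (q :: t).getLast?, R b) →
      ∃ m, (p :: m).IsChain r ∧ (∀ b ∈ (p :: m).getLast?, R b) ∧
        (p :: m).Perm (p :: s ++ q :: t) := by
    intro p q s t hn hpq hs ht hsR htR
    cases s with
    | nil => exact ⟨q :: t, by simp [hpq, ht], by simpa [List.getLast?_cons_cons] using htR, by simp⟩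
    | cons p' s =>
      rw [List.isChain_cons_cons] at hs
      obtain ⟨h, m, hh, hm, hmR, hperm⟩ := ih (s.length + t.length) (by simp at hn; omega)
        p' q s t rfl hs.2 ht (by simpa [List.getLast?_cons_cons] using hsR) htR
      refine ⟨h :: m, ?_, by simpa [List.getLast?_cons_cons] using hmR, hperm.cons p⟩
      rw [List.isChain_cons_cons]
      rcases hh with rfl | rfl
      exacts [⟨hs.1, hm⟩, ⟨hpq, hm⟩]
  intro p q s t hn hs ht hsR htR
  rcases tot p q with h | h
  · obtain ⟨m, h1, h2, h3⟩ := key p q s t hn h hs ht hsR htR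
    exact ⟨p, m, .inl rfl, h1, h2, h3⟩
  · obtain ⟨m, h1, h2, h3⟩ := key q p t s (by omega) h ht hs htR hsR
    exact ⟨q, m, .inr rfl, h1, h2, h3.trans List.perm_append_comm⟩

/-- Path-mergeability of semicomplete digraphs. -/
theorem IsLinkingPath.exists_merge {α : Type*} {r : α → α → Prop} (tot : ∀ a b, r a b ∨ r b a)
    {S R : α → Prop} {P Q : List α} (hP : IsLinkingPath r S R P) (hQ : IsLinkingPath r S R Q) :
    ∃ l, IsLinkingPath r S R l ∧ l.Perm (P ++ Q) := by
  obtain ⟨hP0, hPc, hPS, hPR⟩ := hP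
  obtain ⟨hQ0, hQc, hQS, hQR⟩ := hQ
  obtain ⟨p, s, rfl⟩ := List.exists_cons_of_ne_nil hP0
  obtain ⟨q, t, rfl⟩ := List.exists_cons_of_ne_nil hQ0
  obtain ⟨h, m, hh, hm, hmR, hperm⟩ := exists_chain_merge tot _ p q s t rfl hPc hQc hPR hQR
  refine ⟨h :: m, ⟨by simp, hm, ?_, hmR⟩, hperm⟩
  rcases hh with rfl | rfl
  · simpa using hPS
  · simpa using hQS

theorem IsLinkingPath.exists_merge_flatten {α : Type*} {r : α → α → Prop}
    (tot : ∀ a b, r a b ∨ r b a) {S R : α → Prop} (F : List (List α)) :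
    ∀ P, IsLinkingPath r S R P → (∀ Q ∈ F, IsLinkingPath r S R Q) →
      ∃ l, IsLinkingPath r S R l ∧ l.Perm (P ++ F.flatten) := by
  induction F with
  | nil => exact fun P hP _ => ⟨P, hP, by simp⟩
  | cons Q F ih =>
    intro P hP hF
    obtain ⟨l, hl, hlp⟩ := hP.exists_merge tot (hF Q (by simp))
    obtain ⟨m, hm, hmp⟩ := ih l hl fun Q' h => hF Q' (by simp [h])
    refine ⟨m, hm, hmp.trans ?_⟩
    simpa using hlp.append_right F.flatten

/-! ### Hamiltonian cycles in strong semicomplete digraphs -/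

/-- If a property of vertices is inherited along consecutive pairs of a list, then it passes
from any member of the list to the last one. -/
theorem List.forall_getLast?_of_step {α : Type*} {p : α → Prop} :
    ∀ l : List α, (∀ (s t : List α) (a b : α), l = s ++ a :: b :: t → p a → p b) →
      ∀ a ∈ l, p a → ∀ b ∈ l.getLast?, p b
  | [], _, a, ha, _ => by simp at ha
  | [c], _, a, ha, hp => by simp_all
  | c :: d :: l, h, a, ha, hp => by
    intro b hb
    rw [List.getLast?_cons_cons] at hb
    have ih := List.forall_getLast?_of_step (p := p) (d :: l) fun s t a b hs =>
      h (c :: s) t a b (by simp [hs])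
    rcases List.mem_cons.1 ha with rfl | ha
    · exact ih d (by simp) (h [] l a d rfl hp) b hb
    · exact ih a ha hp b hb

theorem List.forall_head?_of_step {α : Type*} {p : α → Prop} (l : List α)
    (h : ∀ (s t : List α) (a b : α), l = s ++ a :: b :: t → p b → p a)
    (a : α) (ha : a ∈ l) (hp : p a) (b : α) (hb : b ∈ l.head?) : p b := by
  refine List.forall_getLast?_of_step l.reverse (fun s t c d hs => ?_) a (by simpa) hp b (by simpa)
  exact h t.reverse s.reverse d c (by rw [← List.reverse_reverse l, hs]; simp)

/-- Camion's theorem: a strong semicomplete digraph has a Hamiltonian cycle (written here as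
a closed list based at an arbitrary vertex `z`). -/
theorem exists_hamiltonian_closed_list {α : Type*} [Fintype α] {r : α → α → Prop}
    (tot : ∀ a b, r a b ∨ r b a) (strong : ∀ a b, Relation.ReflTransGen r a b) (z : α) :
    ∃ l : List α, (z :: l).Nodup ∧ (z :: (l ++ [z])).IsChain r ∧ ∀ a, a ∈ z :: l := by
  suffices H : ∀ (n : ℕ) (l : List α), Fintype.card α - l.length = n → (z :: l).Nodup →
      (z :: (l ++ [z])).IsChain r →
      ∃ l : List α, (z :: l).Nodup ∧ (z :: (l ++ [z])).IsChain r ∧ ∀ a, a ∈ z :: l from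
    H _ [] rfl (by simp) (by simpa using tot z z)
  intro n
  induction n using Nat.strong_induction_on with
  | _ n ih =>
  intro l hn hnd hch
  have next : ∀ l' : List α, l.length < l'.length → (z :: l').Nodup →
      (z :: (l' ++ [z])).IsChain r →
      ∃ l : List α, (z :: l).Nodup ∧ (z :: (l ++ [z])).IsChain r ∧ ∀ a, a ∈ z :: l := by
    intro l' hlen hnd' hch'
    have := hnd'.length_le_card
    simp only [List.length_cons] at this
    exact ih _ (by omega) l' rfl hnd' hch'
  by_cases hall : ∀ a, a ∈ z :: l
  · exact ⟨l, hnd, hch, hall⟩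
  by_contra hno
  have insert : ∀ (s t : List α) (a b v : α), z :: (l ++ [z]) = s ++ a :: b :: t → v ∉ z :: l →
      r a v → ¬ r v b := by
    intro s t a b v hs hv hav hvb
    have hch' : (s ++ a :: v :: b :: t).IsChain r := by
      rw [hs, List.isChain_append_cons_cons] at hch
      rw [List.isChain_append_cons_cons, List.isChain_cons_cons]
      exact ⟨hch.1, hav, hvb, hch.2.2⟩
    obtain ⟨s', hs'⟩ : ∃ s', s ++ [a] = z :: s' := by
      cases s with
      | nil => simp at hs; exact ⟨[], by simp [hs.1]⟩
      | cons c s => simp at hs; exact ⟨s ++ [a], by simp [hs.1]⟩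
    obtain ⟨t', ht'⟩ : ∃ t', b :: t = t' ++ [z] := by
      have : (s ++ a :: b :: t).getLast? = some z := by
        rw [← hs, ← List.cons_append, List.getLast?_concat]
      obtain ⟨t', c, ht'⟩ : ∃ t' c, b :: t = t' ++ [c] :=
        ⟨_, _, (List.dropLast_append_getLast (List.cons_ne_nil b t)).symm⟩
      rw [ht', show s ++ a :: (t' ++ [c]) = (s ++ a :: t') ++ [c] by simp,
        List.getLast?_concat, Option.some_inj] at this
      exact ⟨t', by rw [ht', this]⟩
    have hl : l = s' ++ t' := by
      have : (z :: l) ++ [z] = (z :: (s' ++ t')) ++ [z] := by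
        rw [List.cons_append, hs, show s ++ a :: b :: t = (s ++ [a]) ++ (b :: t) by simp, hs', ht']
        simp
      simpa using List.append_cancel_right this
    refine hno (next (s' ++ v :: t') (by simp [hl]) ?_ ?_)
    · have hp : (z :: (s' ++ v :: t')).Perm (v :: z :: l) := by
        rw [hl]
        exact (List.perm_middle.cons z).trans (List.Perm.swap v z _)
      rw [hp.nodup_iff]
      exact List.nodup_cons.2 ⟨hv, hnd⟩
    · rw [show s ++ a :: v :: b :: t = (s ++ [a]) ++ v :: (b :: t) by simp, hs', ht'] at hch'
      simpa using hch'
  have fwd : ∀ v, v ∉ z :: l → ∀ c ∈ z :: l, r c v → r z v := fun v hv c hc hcv =>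
    List.forall_getLast?_of_step (p := fun a => r a v) (z :: (l ++ [z]))
      (fun s t a b hs ha => (tot b v).resolve_right (insert s t a b v hs hv ha)) c
      (by rw [← List.cons_append]; exact List.mem_append_left _ hc) hcv z
      (by rw [← List.cons_append, List.getLast?_concat]; rfl)
  have bwd : ∀ v, v ∉ z :: l → ∀ c ∈ z :: l, r z v → ¬ r v c := by
    intro v hv c hc hzv hvc
    have hz : r v z := List.forall_head?_of_step (p := fun a => r v a) (z :: (l ++ [z]))
      (fun s t a b hs hb => (tot v a).resolve_right fun h => insert s t a b v hs hv h hb) c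
      (by rw [← List.cons_append]; exact List.mem_append_left _ hc) hvc z (by simp)
    have hall : ∀ (s t : List α) (a b : α), z :: (l ++ [z]) = s ++ a :: b :: t →
        r a v → r b v := fun s t a b hs ha =>
      (tot b v).resolve_right (insert s t a b v hs hv ha)
    -- the last arc of the closed list enters `z`, and its tail dominates `v`
    obtain ⟨s, a, hsa⟩ : ∃ s a, z :: l = s ++ [a] :=
      ⟨_, _, (List.dropLast_append_getLast (List.cons_ne_nil z l)).symm⟩
    have hav : r a v := by
      refine List.forall_getLast?_of_step (p := fun a => r a v) (z :: l)
        (fun s t a b hs => hall s (t ++ [z]) a b ?_) z (by simp) hzv a (by rw [hsa]; simp)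
      rw [← List.cons_append, hs]; simp
    exact insert s [] a z v (by rw [← List.cons_append, hsa]; simp) hv hav hz
  have cross : ∀ v w, v ∉ z :: l → w ∉ z :: l → r z v → ¬ r z w → ¬ r v w := by
    intro v w hv hw hzv hzw hvw
    have hne : v ≠ w := by rintro rfl; exact hzw hzv
    refine hno (next (v :: w :: l) (by simp) ?_ ?_)
    · have hp : (z :: v :: w :: l).Perm (v :: w :: z :: l) :=
        (List.Perm.swap v z _).trans ((List.Perm.swap w z _).cons v)
      rw [hp.nodup_iff]
      refine List.nodup_cons.2 ⟨?_, List.nodup_cons.2 ⟨hw, hnd⟩⟩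
      rw [List.mem_cons]
      exact fun h => h.elim hne hv
    · have hw' : ∀ b ∈ z :: l, r w b := fun b hb =>
        (tot w b).resolve_right fun h => hzw (fwd w hw b hb h)
      rw [List.isChain_cons] at hch
      simp only [List.cons_append, List.isChain_cons_cons]
      refine ⟨hzv, hvw, List.isChain_cons.2 ⟨fun b hb => hw' b ?_, hch.2⟩⟩
      cases l with
      | nil => simp at hb; simp [hb]
      | cons c l => simp at hb; simp [hb]
  push Not at hall
  obtain ⟨v₀, hv₀⟩ := hall
  have out : ∀ a, Relation.ReflTransGen r z a → a ∈ z :: l ∨ r z a := by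
    intro a ha
    induction ha with
    | refl => simp
    | @tail b c _ hbc ih =>
      by_cases hc : c ∈ z :: l
      · exact .inl hc
      right
      by_contra hzc
      by_cases hb : b ∈ z :: l
      · exact hzc (fwd c hc b hb hbc)
      · exact cross b c hb hc (ih.resolve_left hb) hzc hbc
  have hstay : ∀ a, Relation.ReflTransGen r v₀ a → a ∉ z :: l := by
    intro a ha
    induction ha with
    | refl => exact hv₀
    | @tail b c _ hbc ih =>
      exact fun hc => bwd b ih c hc ((out b (strong z b)).resolve_left ih) hbc
  exact hstay z (strong v₀ z) (by simp)

/-- In a strong semicomplete digraph, the complement of a nonempty proper vertex set `Q` has a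
Hamiltonian path whose ends are joined to `Q`. -/
theorem exists_hamiltonian_path_compl {α : Type*} [Fintype α] {r : α → α → Prop}
    (tot : ∀ a b, r a b ∨ r b a) (strong : ∀ a b, Relation.ReflTransGen r a b)
    (Q : α → Prop) (hQ : ∃ q, Q q) (hQ' : ∃ q, ¬ Q q) :
    ∃ l : List α, l.Nodup ∧ (∀ a, a ∈ l ↔ ¬ Q a) ∧
      IsLinkingPath r (fun a => ∃ q, Q q ∧ r q a) (fun a => ∃ q, Q q ∧ r a q) l := by
  let π : α → Option {a // ¬ Q a} := fun a => if h : Q a then none else some ⟨a, h⟩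
  have hπQ : ∀ a, Q a → π a = none := fun a h => by simp [π, h]
  have hπ : ∀ a : {a // ¬ Q a}, π a = some a := fun a => by simp [π, a.2]
  have hnone : ∀ a, π a = none → Q a := fun a h => by by_contra h'; simp [π, h'] at h
  have hsome : ∀ a (b : {a // ¬ Q a}), π a = some b → a = b := fun a b h => by
    by_cases h' : Q a
    · simp [π, h'] at h
    · simp [π, h'] at h; rw [← h]
  have hsurj : Function.Surjective π := by
    rintro (_ | a)
    · exact hQ.imp hπQ
    · exact ⟨a, hπ a⟩
  let r' : Option {a // ¬ Q a} → Option {a // ¬ Q a} → Prop :=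
    fun u v => ∃ a b, π a = u ∧ π b = v ∧ r a b
  obtain ⟨l, hnd, hch, hmem⟩ := exists_hamiltonian_closed_list (r := r')
    (fun u v => by
      obtain ⟨a, rfl⟩ := hsurj u
      obtain ⟨b, rfl⟩ := hsurj v
      exact (tot a b).imp (fun h => ⟨a, b, rfl, rfl, h⟩) fun h => ⟨b, a, rfl, rfl, h⟩)
    (fun u v => by
      obtain ⟨a, rfl⟩ := hsurj u
      obtain ⟨b, rfl⟩ := hsurj v
      exact (strong a b).lift π fun a b h => ⟨a, b, rfl, rfl, h⟩) none
  obtain ⟨hn, hnd⟩ := List.nodup_cons.1 hnd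
  obtain ⟨l, rfl⟩ : l ∈ Set.range (List.map some) := by
    rw [Set.range_list_map]
    rintro (_ | a) hu
    · exact absurd hu hn
    · exact ⟨a, rfl⟩
  have hmem' : ∀ a : {a // ¬ Q a}, a ∈ l := fun a => by simpa using hmem (some a)
  have hl : l ≠ [] := by
    obtain ⟨q, hq⟩ := hQ'
    exact List.ne_nil_of_mem (hmem' ⟨q, hq⟩)
  rw [List.isChain_cons, List.isChain_append, List.isChain_map] at hch
  refine ⟨l.map Subtype.val, ?_, ?_, fun h => hl (List.map_eq_nil_iff.1 h), ?_, ?_, ?_⟩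
  · exact (List.Nodup.of_map _ hnd).map Subtype.val_injective
  · intro a
    simp only [List.mem_map, Subtype.exists, exists_and_right, exists_eq_right]
    exact ⟨fun ⟨h, _⟩ => h, fun h => ⟨h, hmem' _⟩⟩
  · rw [List.isChain_map]
    refine hch.2.1.imp fun a b ⟨c, d, hc, hd, h⟩ => ?_
    rwa [hsome _ _ hc, hsome _ _ hd] at h
  · intro a ha
    rw [List.head?_map, Option.mem_map] at ha
    obtain ⟨a, ha, rfl⟩ := ha
    obtain ⟨c, d, hc, hd, h⟩ := hch.1 (some a) (by
      rw [List.head?_append_of_ne_nil _ (by simpa using hl), List.head?_map, ha]; rfl)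
    exact ⟨c, hnone c hc, hsome _ _ hd ▸ h⟩
  · intro a ha
    rw [List.getLast?_map, Option.mem_map] at ha
    obtain ⟨a, ha, rfl⟩ := ha
    obtain ⟨c, d, hc, hd, h⟩ := hch.2.2.2 (some a) (by rw [List.getLast?_map, ha]; rfl) none
      (by simp)
    exact ⟨d, hnone d hd, hsome _ _ hc ▸ h⟩

/-! ### Spanning paths -/

/-- If `p` holds at the first but not at the last element of a list, the list splits between an
element satisfying `p` and an element violating it. -/
theorem List.exists_split_of_head?_of_getLast? {α : Type*} {p : α → Prop} :
    ∀ l : List α, l ≠ [] → (∀ a ∈ l.head?, p a) → (∀ a ∈ l.getLast?, ¬ p a) →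
      ∃ s t a b, l = s ++ a :: b :: t ∧ p a ∧ ¬ p b
  | [], h, _, _ => absurd rfl h
  | [a], _, h, h' => absurd (h a (by simp)) (h' a (by simp))
  | a :: b :: l, _, h, h' => by
    by_cases hb : p b
    · obtain ⟨s, t, c, d, hs, hc, hd⟩ := List.exists_split_of_head?_of_getLast? (b :: l) (by simp)
        (by simpa using hb) (by simpa [List.getLast?_cons_cons] using h')
      exact ⟨a :: s, t, c, d, by simp [hs], hc, hd⟩
    · exact ⟨[], l, a, b, rfl, h a (by simp), hb⟩

theorem IsLinkingPath.append {α : Type*} {r : α → α → Prop} {S S' R R' : α → Prop}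
    {P Q : List α} (hP : IsLinkingPath r S R' P) (hQ : IsLinkingPath r S' R Q)
    (h : ∀ a ∈ P.getLast?, ∀ b ∈ Q.head?, r a b) : IsLinkingPath r S R (P ++ Q) := by
  refine ⟨by simp [hP.1], List.isChain_append.2 ⟨hP.2.1, hQ.2.1, h⟩, ?_, ?_⟩
  · rw [List.head?_append_of_ne_nil _ hP.1]
    exact hP.2.2.1
  · rw [List.getLast?_append_of_ne_nil _ hQ.1]
    exact hQ.2.2.2

/-- In a strong semicomplete digraph, three disjoint paths from `S` to `R` can be
transformed into a Hamiltonian path from `S` to `R`. -/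
theorem exists_spanning_linking_path {α : Type*} [Fintype α] {r : α → α → Prop}
    (tot : ∀ a b, r a b ∨ r b a) (strong : ∀ a b, Relation.ReflTransGen r a b)
    (S R : α → Prop) (F : List (List α)) (hlen : 3 ≤ F.length)
    (hF : ∀ P ∈ F, IsLinkingPath r S R P) (hnd : F.flatten.Nodup) :
    ∃ l, IsLinkingPath r S R l ∧ l.Nodup ∧ ∀ a, a ∈ l := by
  induction hn : Fintype.card α - F.flatten.length using Nat.strong_induction_on
    generalizing F with
  | _ n ih =>
  by_contra hno
  -- families of paths covering everything, or more than `F`, are excluded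
  have merge : ∀ (l : List α) (G : List (List α)), IsLinkingPath r S R l →
      (∀ Q ∈ G, IsLinkingPath r S R Q) → (l ++ G.flatten).Nodup →
      (∀ a, a ∈ l ++ G.flatten) → False := by
    intro l G hl hG hnd' hmem
    obtain ⟨m, hm, hp⟩ := IsLinkingPath.exists_merge_flatten tot G l hl hG
    exact hno ⟨m, hm, hp.nodup_iff.2 hnd', fun a => hp.mem_iff.2 (hmem a)⟩
  have insert : ∀ P ∈ F, ∀ (s t : List α) (a b v : α), P = s ++ a :: b :: t → v ∉ F.flatten →
      r a v → ¬ r v b := by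
    intro P hPF s t a b v hP hv hav hvb
    have hp : ((s ++ a :: v :: b :: t) :: F.erase P).flatten.Perm (v :: F.flatten) := by
      refine List.Perm.trans ?_ ((List.perm_cons_erase hPF).flatten.symm.cons v)
      rw [hP]
      refine List.perm_iff_count.2 fun x => ?_
      simp only [List.flatten_cons, List.count_append, List.count_cons]
      omega
    have hnd' := hp.nodup_iff.2 (List.nodup_cons.2 ⟨hv, hnd⟩)
    have hcard := hnd'.length_le_card
    have hl := hp.length_eq
    rw [List.length_cons] at hl
    refine hno (ih _ ?_ _ ?_ ?_ hnd' rfl)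
    · omega
    · rw [List.length_cons, List.length_erase_of_mem hPF]
      omega
    · intro Q hQ
      rcases List.mem_cons.1 hQ with rfl | hQ
      · obtain ⟨_, h1, h2, h3⟩ := hF P hPF
        subst hP
        rw [List.isChain_append_cons_cons] at h1
        refine ⟨by simp, ?_, ?_, ?_⟩
        · rw [List.isChain_append_cons_cons, List.isChain_cons_cons]
          exact ⟨h1.1, hav, hvb, h1.2.2⟩
        · cases s <;> simpa using h2
        · simpa [List.getLast?_append_cons, List.getLast?_cons_cons] using h3
      · exact hF Q (List.mem_of_mem_erase hQ)
  have out : ∀ P ∈ F, ∀ v, v ∉ F.flatten → ∀ c ∈ P, r c v → ∀ b ∈ P.getLast?, r b v :=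
    fun P hP v hv => List.forall_getLast?_of_step (p := fun a => r a v) P
      fun s t a b hs ha => (tot b v).resolve_right (insert P hP s t a b v hs hv ha)
  have inn : ∀ P ∈ F, ∀ v, v ∉ F.flatten → ∀ c ∈ P, r v c → ∀ b ∈ P.head?, r v b :=
    fun P hP v hv => List.forall_head?_of_step (p := fun a => r v a) P
      fun s t a b hs hb => (tot v a).resolve_right fun h => insert P hP s t a b v hs hv h hb
  obtain ⟨P₀, F₀, rfl⟩ : ∃ P₀ F₀, F = P₀ :: F₀ :=
    List.exists_cons_of_ne_nil (by rintro rfl; simp at hlen)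
  have hne : ∃ q, q ∉ (P₀ :: F₀).flatten := by
    by_contra! hall
    exact merge P₀ F₀ (hF _ (by simp)) (fun Q hQ => hF Q (by simp [hQ])) hnd hall
  obtain ⟨q₀, hq₀⟩ := List.exists_mem_of_ne_nil _ (hF P₀ (by simp)).1
  generalize hFF : P₀ :: F₀ = F at *
  obtain ⟨U, hUnd, hUmem, hU⟩ := exists_hamiltonian_path_compl tot strong (· ∈ F.flatten)
    ⟨q₀, by rw [← hFF]; simp [hq₀]⟩ hne
  have hFU : (F.flatten ++ U).Nodup :=
    List.nodup_append'.2 ⟨hnd, hUnd, fun a ha ha' => (hUmem a).1 ha' ha⟩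
  have hFUmem : ∀ a, a ∈ F.flatten ++ U := fun a => by
    by_cases h : a ∈ F.flatten <;> simp [hUmem, h]
  have finish : ∀ (l : List α) (G : List (List α)), IsLinkingPath r S R l →
      (∀ Q ∈ G, IsLinkingPath r S R Q) → (l ++ G.flatten).Perm (F.flatten ++ U) → False :=
    fun l G hl hG hp => merge l G hl hG (hp.nodup_iff.2 hFU) fun a => hp.mem_iff.2 (hFUmem a)
  have direct : ∀ (P Q : List α) (G : List (List α)), F.Perm (P :: Q :: G) →
      (∀ a ∈ P.getLast?, ∀ b ∈ U.head?, r a b) → ¬ ∀ a ∈ U.getLast?, ∀ b ∈ Q.head?, r a b := by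
    intro P Q G hp h1 h2
    have hF' : ∀ Q' ∈ P :: Q :: G, IsLinkingPath r S R Q' := fun Q' h => hF Q' (hp.mem_iff.2 h)
    refine finish (P ++ (U ++ Q)) G ((hF' P (by simp)).append (hU.append (hF' Q (by simp)) h2) ?_)
      (fun Q' h => hF' Q' (by simp [h])) ?_
    · rwa [List.head?_append_of_ne_nil _ hU.1]
    · refine List.Perm.trans ?_ (hp.flatten.symm.append_right U)
      refine List.perm_iff_count.2 fun x => ?_
      simp only [List.flatten_cons, List.count_append]
      omega
  obtain ⟨P, hP, hPU⟩ : ∃ P ∈ F, ∀ a ∈ P.getLast?, ∀ b ∈ U.head?, r a b := by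
    obtain ⟨u, t, hu⟩ := List.exists_cons_of_ne_nil hU.1
    obtain ⟨q, hq, hqu⟩ := hU.2.2.1 u (by simp [hu])
    obtain ⟨P, hP, hqP⟩ := List.mem_flatten.1 hq
    refine ⟨P, hP, fun a ha b hb => ?_⟩
    obtain rfl : u = b := by simpa [hu] using hb
    exact out P hP u ((hUmem u).1 (by simp [hu])) q hqP hqu a ha
  obtain ⟨Q, hQ, hUQ⟩ : ∃ Q ∈ F, ∀ a ∈ U.getLast?, ∀ b ∈ Q.head?, r a b := by
    have hu := List.getLast?_eq_some_getLast hU.1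
    obtain ⟨q, hq, hqu⟩ := hU.2.2.2 _ hu
    obtain ⟨Q, hQ, hqQ⟩ := List.mem_flatten.1 hq
    refine ⟨Q, hQ, fun a ha b hb => ?_⟩
    obtain rfl := Option.some_inj.1 (hu.symm.trans ha)
    exact inn Q hQ _ ((hUmem _).1 (List.getLast_mem _)) q hqQ hqu b hb
  have hFP := List.perm_cons_erase hP
  by_cases hQP : Q ∈ F.erase P
  · exact direct P Q _ (hFP.trans ((List.perm_cons_erase hQP).cons P)) hPU hUQ
  obtain rfl : Q = P := (List.mem_cons.1 (hFP.mem_iff.1 hQ)).resolve_right hQP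
  -- both ends of `U` attach to `Q`: split `U` and use the two other paths
  obtain ⟨X, Y, G, hXY⟩ : ∃ X Y G, F.erase Q = X :: Y :: G := by
    have := hFP.length_eq
    rcases h : F.erase Q with _ | ⟨X, _ | ⟨Y, G⟩⟩
    · simp [h] at this; omega
    · simp [h] at this; omega
    · exact ⟨X, Y, G, rfl⟩
  rw [hXY] at hFP
  have hswap : F.Perm (Q :: Y :: X :: G) := hFP.trans ((List.Perm.swap _ _ _).cons Q)
  have hX : X ∈ F := hFP.mem_iff.2 (by simp)
  have cross : ∀ (X Y s t : List α) (a b : α), F.Perm (Q :: X :: Y :: G) →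
      U = s ++ a :: b :: t → (∀ c ∈ X.head?, r a c) → ¬ (∀ c ∈ Y.head?, r b c) → False := by
    intro X Y s t a b hp hs hX hY
    have hF' : ∀ Q' ∈ Q :: X :: Y :: G, IsLinkingPath r S R Q' := fun Q' h => hF Q' (hp.mem_iff.2 h)
    obtain ⟨_, hUc, -, -⟩ := hU
    push Not at hY
    obtain ⟨c, hc, hbc⟩ := hY
    have hYb : ∀ c ∈ Y.getLast?, r c b := out Y (hp.mem_iff.2 (by simp)) b
      ((hUmem b).1 (by simp [hs])) c (List.mem_of_mem_head? hc) ((tot c b).resolve_right hbc)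
    have hU1 : IsLinkingPath r (fun _ => True) (fun _ => True) (s ++ [a]) := by
      rw [hs, List.isChain_append_cons_cons] at hUc
      exact ⟨by simp, hUc.1, by simp, by simp⟩
    have hU2 : IsLinkingPath r (fun _ => True) (fun _ => True) (b :: t) := by
      rw [hs, List.isChain_append_cons_cons] at hUc
      exact ⟨by simp, hUc.2.2, by simp, by simp⟩
    have h1 : IsLinkingPath r (fun _ => True) R (s ++ [a] ++ X) :=
      hU1.append (hF' X (by simp)) fun d hd e he => by
        obtain rfl : a = d := by simpa using hd
        exact hX e he
    have h2 : IsLinkingPath r S R (Q ++ (s ++ [a] ++ X)) :=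
      (hF' Q (by simp)).append h1 fun d hd e he => hPU d hd e (by
        rw [hs]
        cases s <;> simpa using he)
    have h3 : IsLinkingPath r (fun _ => True) R (b :: t ++ (Q ++ (s ++ [a] ++ X))) :=
      hU2.append h2 fun d hd e he => by
        rw [List.head?_append_of_ne_nil _ (hF' Q (by simp)).1] at he
        exact hUQ d (by rw [hs, List.getLast?_append_cons, List.getLast?_cons_cons]; exact hd) e he
    refine finish (Y ++ (b :: t ++ (Q ++ (s ++ [a] ++ X)))) G
      ((hF' Y (by simp)).append h3 fun d hd e he => ?_) (fun Q' h => hF' Q' (by simp [h])) ?_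
    · obtain rfl : b = e := by simpa using he
      exact hYb d hd
    · refine List.Perm.trans ?_ (hp.flatten.symm.append_right U)
      rw [hs]
      refine List.perm_iff_count.2 fun x => ?_
      simp only [List.flatten_cons, List.count_append, List.count_cons, List.count_nil]
      omega
  obtain ⟨s, t, a, b, hs, ha, hb⟩ := List.exists_split_of_head?_of_getLast?
    (p := fun w => (∀ c ∈ X.head?, r w c) ∨ ∀ c ∈ Y.head?, r w c) U hU.1
    (fun w hw => .inl fun c hc => (tot w c).resolve_right fun hcw =>
      direct X Q (Y :: G) (hFP.trans (List.Perm.swap _ _ _)) (fun d hd e he => by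
        obtain rfl := Option.some_inj.1 (hw.symm.trans he)
        exact out X hX w ((hUmem w).1 (List.mem_of_mem_head? hw)) c (List.mem_of_mem_head? hc)
          hcw d hd) hUQ)
    (fun w hw h => by
      rcases h with h | h
      · refine direct Q X _ hFP hPU fun d hd e he => ?_
        obtain rfl := Option.some_inj.1 (hw.symm.trans hd)
        exact h e he
      · refine direct Q Y _ hswap hPU fun d hd e he => ?_
        obtain rfl := Option.some_inj.1 (hw.symm.trans hd)
        exact h e he)
  rw [not_or] at hb
  rcases ha with ha | ha
  · exact cross X Y s t a b hFP hs ha hb.2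
  · exact cross Y X s t a b hswap hs ha hb.1

/-- Thomassen's theorem: every 4-strong semicomplete digraph is Hamiltonian-connected. Here `r` is
the (reflexive) arc relation of the digraph. -/
theorem KStrong.exists_hamiltonian_path {α : Type*} [Fintype α] {r : α → α → Prop}
    (tot : ∀ a b, r a b ∨ r b a) (h4 : KStrong r 4) {x y : α} (hxy : x ≠ y) :
    ∃ l : List α, (x :: (l ++ [y])).Nodup ∧ (x :: (l ++ [y])).IsChain r ∧
      ∀ a, a ∈ x :: (l ++ [y]) := by
  let T := {v // v ≠ x ∧ v ≠ y}
  let r' : T → T → Prop := fun a b => r a b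
  have hT : ∀ a : T, (a : α) ≠ x ∧ (a : α) ≠ y := fun a => a.2
  have strong' : ∀ a b : T, Relation.ReflTransGen r' a b := by
    intro a b
    have h := h4.2 {x, y} ((Finset.card_insert_le _ _).trans (by simp)) a b
      (by simpa using hT a) (by simpa using hT b)
    have key : ∀ c, Relation.ReflTransGen (fun a b => r a b ∧ a ∉ ((({x, y} : Finset α)) : Set α) ∧
        b ∉ ((({x, y} : Finset α)) : Set α)) (a : α) c →
        ∀ hc : c ≠ x ∧ c ≠ y, Relation.ReflTransGen r' a ⟨c, hc⟩ := by
      intro c hc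
      induction hc with
      | refl => exact fun _ => .refl
      | tail _ h ih => exact fun hc => (ih (by simpa using h.2.1)).tail h.1
    exact key b h b.2
  obtain ⟨F, hFl, hF, hFnd⟩ := exists_linking_paths (r := r') (fun a => (tot a a).elim id id)
    (fun v : T => r x v) (fun v : T => r v y) 3 (by
    intro Z X hZR hSZ hZ
    by_contra! hcard
    -- deleting `X` and `y`, the vertex `x` only reaches `Z`
    have h1 : ∀ v : T, v ∈ Z ∨ v ∈ X := by
      intro v
      by_cases hv : v ∈ X
      · exact .inr hv
      set X' : Finset α := insert y (X.map (Function.Embedding.subtype _)) with hX'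
      have hX'T : ∀ u : T, (u : α) ∈ X' ↔ u ∈ X := fun u => by
        simp [hX', (hT u).2, u.2]
      have hx : x ∉ X' := by simp [hX', hxy]
      have h := h4.2 X' ((Finset.card_insert_le _ _).trans (by simp; omega)) x v
        (by simpa using hx) (by simpa [hX'T] using hv)
      have key : ∀ c, Relation.ReflTransGen (fun a b => r a b ∧ a ∉ (X' : Set α) ∧
          b ∉ (X' : Set α)) x c → ∀ hc : c ≠ x ∧ c ≠ y, (⟨c, hc⟩ : T) ∈ Z := by
        intro c hc
        induction hc with
        | refl => exact fun hc => absurd rfl hc.1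
        | @tail b c _ h ih =>
          intro hc
          have hcX : (⟨c, hc⟩ : T) ∉ X := by
            rw [← hX'T]
            simpa using h.2.2
          have hby : b ≠ y := by
            rintro rfl
            exact h.2.1 (by simp [hX'])
          by_cases hbx : b = x
          · subst hbx
            exact (hSZ ⟨c, hc⟩ h.1).resolve_right hcX
          · exact (hZ _ (ih ⟨hbx, hby⟩) ⟨c, hc⟩ h.1).resolve_right hcX
      exact .inl (key v h v.2)
    -- deleting `X` and `x`, nothing reaches `y`
    set X' : Finset α := insert x (X.map (Function.Embedding.subtype _)) with hX'
    have hX'T : ∀ u : T, (u : α) ∈ X' ↔ u ∈ X := fun u => by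
      simp [hX', (hT u).1, u.2]
    have hX'c : X'.card ≤ 3 := (Finset.card_insert_le _ _).trans (by simp; omega)
    have hy : y ∉ X' := by simp [hX', hxy.symm]
    obtain ⟨v, hv⟩ : ∃ v, v ∉ insert y X' := by
      by_contra! hall
      have h5 : Fintype.card α ≤ (insert y X').card :=
        Finset.card_le_card fun a _ => hall a
      have := Finset.card_insert_le y X'
      have := h4.1
      omega
    rw [Finset.mem_insert, not_or] at hv
    have h := h4.2 X' hX'c v y (by simpa using hv.2) (by simpa using hy)
    have key : ∀ c, Relation.ReflTransGen (fun a b => r a b ∧ a ∉ (X' : Set α) ∧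
        b ∉ (X' : Set α)) v c → c ≠ y := by
      intro c hc
      induction hc with
      | refl => exact hv.1
      | @tail b c _ h ih =>
        rintro rfl
        have hbx : b ≠ x := by
          rintro rfl
          exact h.2.1 (by simp [hX'])
        have hbX : (⟨b, hbx, ih⟩ : T) ∉ X := by
          rw [← hX'T]
          simpa using h.2.1
        exact hZR _ ((h1 ⟨b, hbx, ih⟩).resolve_right hbX) h.1
    exact key y h rfl)
  obtain ⟨l, ⟨hl0, hlc, hlS, hlR⟩, hlnd, hlmem⟩ := exists_spanning_linking_path (r := r')
    (fun a b => tot a b) strong' _ _ F hFl.ge hF hFnd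
  have hmem : ∀ a, a ∈ x :: (l.map Subtype.val ++ [y]) := fun a => by
    by_cases hax : a = x
    · simp [hax]
    by_cases hay : a = y
    · simp [hay]
    · have : a ∈ l.map Subtype.val := List.mem_map.2 ⟨⟨a, hax, hay⟩, hlmem _, rfl⟩
      exact List.mem_cons_of_mem _ (List.mem_append_left _ this)
  refine ⟨l.map Subtype.val, ?_, ?_, hmem⟩
  · rw [List.nodup_cons, List.nodup_append']
    refine ⟨?_, hlnd.map Subtype.val_injective, by simp, ?_⟩
    · simp [hxy]
    · simp
  · rw [List.isChain_cons, List.isChain_append, List.isChain_map]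
    refine ⟨fun a ha => ?_, hlc, by simp, fun a ha b hb => ?_⟩
    · rw [List.head?_append_of_ne_nil _ (fun h => hl0 (List.map_eq_nil_iff.1 h)),
        List.head?_map, Option.mem_map] at ha
      obtain ⟨a, ha, rfl⟩ := ha
      exact hlS a ha
    · rw [List.getLast?_map, Option.mem_map] at ha
      obtain ⟨a, ha, rfl⟩ := ha
      obtain rfl : y = b := by simpa using hb
      exact hlR a ha

/-- Every 4-strong semicomplete multipartite digraph has a spanning
`(x,y)`-G-path for every pair of distinct vertices `x`, `y`. -/
theorem stmt3 {V K : Type} [Fintype V] {A : V → V → Prop} {part : V → K}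
    (hSMD : IsSMD A part) (h4 : KStrong A 4) (x y : V) (hxy : x ≠ y) :
    ∃ P : GPath A part, P.verts.head P.ne = x ∧ P.verts.getLast P.ne = y ∧
      ∀ v : V, v ∈ P.verts := by
  have tot : ∀ a b, (A a b ∨ part a = part b) ∨ (A b a ∨ part b = part a) := fun a b => by
    by_cases h : part a = part b
    · exact .inl (.inr h)
    · exact (hSMD.adj a b h).imp .inl .inl
  have h4' : KStrong (fun a b => A a b ∨ part a = part b) 4 :=
    ⟨h4.1, fun X hX u v hu hv => 
      Relation.ReflTransGen.mono (fun a b h => ⟨.inl h.1, h.2⟩) _ _ (h4.2 X hX u v hu hv)⟩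
  obtain ⟨l, hnd, hch, hmem⟩ := h4'.exists_hamiltonian_path tot hxy
  exact ⟨⟨x :: (l ++ [y]), by simp, hnd, hch⟩, by simp, by simp, hmem⟩
end

section
/- In a semicomplete multipartite digraph D, the maximum number of arcs in a G-path of D equals the maximum number of arcs contained in a 1-G-path-G-cycle subdigraph of D (a vertex-disjoint collection consisting of one G-path and zero or more G-cycles). -/
open Classical

universe u v

variable {V : Type u} {K : Type v} {A : V → V → Prop} {part : V → K}

/-- A 1-G-path-G-cycle subdigraph: one G-path together with zero or more G-cycles,
all pairwise vertex-disjoint. -/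
structure GPCS {V : Type} {K : Type} (A : V → V → Prop) (part : V → K) where
  path : GPath A part
  cycles : List (GCycle A part)
  disjc : cycles.Pairwise fun C C' => ∀ x ∈ C.toGPath.verts, x ∉ C'.toGPath.verts
  disjp : ∀ C ∈ cycles, ∀ x ∈ path.verts, x ∉ C.toGPath.verts

/-- The total number of arcs of a 1-G-path-G-cycle subdigraph. -/
noncomputable def GPCS.arcs {V K : Type} {A : V → V → Prop} {part : V → K}
    (F : GPCS A part) : ℕ :=
  F.path.len + (F.cycles.map GCycle.len).sum

namespace SMD

/-- The number of arcs used by consecutive pairs of a list of vertices. -/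
noncomputable def arcCount (A : V → V → Prop) (l : List V) : ℕ :=
  (l.zip l.tail).countP fun q => decide (A q.1 q.2)

/-- The contribution of the pair `(x, y)` to an arc count. -/
noncomputable def ind (A : V → V → Prop) (x y : V) : ℕ := if A x y then 1 else 0

lemma ind_le_one (x y : V) : ind A x y ≤ 1 := by
  unfold ind; split <;> simp

lemma ind_of_arc {x y : V} (h : A x y) : ind A x y = 1 := if_pos h

lemma ind_of_not_arc {x y : V} (h : ¬ A x y) : ind A x y = 0 := if_neg h

lemma arcCount_cons_cons (a b : V) (l : List V) :
    arcCount A (a :: b :: l) = ind A a b + arcCount A (b :: l) := by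
  simp [arcCount, ind, List.countP_cons, add_comm]

lemma arcCount_append {X Y : List V} (hX : X ≠ []) (hY : Y ≠ []) :
    arcCount A (X ++ Y) =
      arcCount A X + ind A (X.getLast hX) (Y.head hY) + arcCount A Y := by
  induction X with
  | nil => exact absurd rfl hX
  | cons a t ih =>
    cases t with
    | nil =>
      cases Y with
      | nil => exact absurd rfl hY
      | cons b Y =>
        simp only [List.cons_append, List.nil_append, arcCount_cons_cons, List.getLast_singleton,
          List.head_cons]
        simp [arcCount]
    | cons b t =>
      have := ih (by simp)
      simp only [List.cons_append, arcCount_cons_cons] at this ⊢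
      rw [this, List.getLast_cons (List.cons_ne_nil b t)]
      ring

lemma countP_zip_append_singleton (a b : V) (t : List V) :
    ((a :: t).zip (t ++ [b])).countP (fun q => decide (A q.1 q.2)) =
      arcCount A (a :: t) + ind A ((a :: t).getLast (by simp)) b := by
  induction t generalizing a with
  | nil => by_cases h : A a b <;> simp [arcCount, ind, h]
  | cons c t ih =>
    rw [arcCount_cons_cons, List.getLast_cons (by simp), List.cons_append, List.zip_cons_cons,
      List.countP_cons, ih]
    simp only [ind, decide_eq_true_eq]
    ring

lemma GCycle_len_eq (C : GCycle A part) :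
    C.len = arcCount A C.verts + ind A (C.verts.getLast C.ne) (C.verts.head C.ne) := by
  obtain ⟨⟨l, ne, nd, ch⟩, cl⟩ := C
  cases l with
  | nil => exact absurd rfl ne
  | cons a t =>
    simpa [GCycle.len] using countP_zip_append_singleton (A := A) a a t

/-- Consecutive vertices of a G-path are joined by an arc or lie in one partite set. -/
def Link (A : V → V → Prop) (part : V → K) (a b : V) : Prop := A a b ∨ part a = part b

lemma isChain_append_iff {R : V → V → Prop} {X Y : List V} (hX : X ≠ []) (hY : Y ≠ []) :
    (X ++ Y).IsChain R ↔ X.IsChain R ∧ Y.IsChain R ∧ R (X.getLast hX) (Y.head hY) := by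
  rw [List.isChain_append]
  simp [List.getLast?_eq_getLast_of_ne_nil hX, List.head?_eq_some_head hY]

/-- `Q` is the vertex list of a G-cycle using `n` arcs. -/
structure IsCyc (A : V → V → Prop) (part : V → K) (n : ℕ) (Q : List V) : Prop where
  ne : Q ≠ []
  chain : Q.IsChain (Link A part)
  close : Link A part (Q.getLast ne) (Q.head ne)
  arcs : arcCount A Q + ind A (Q.getLast ne) (Q.head ne) = n

lemma IsCyc.swap {n : ℕ} {X Y : List V} (h : IsCyc A part n (X ++ Y)) :
    IsCyc A part n (Y ++ X) := by
  by_cases hX : X = []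
  · simpa [hX] using h
  by_cases hY : Y = []
  · simpa [hY] using h
  obtain ⟨_, ch, cl, ar⟩ := h
  rw [isChain_append_iff hX hY] at ch
  rw [arcCount_append hX hY] at ar
  simp only [List.getLast_append_of_ne_nil _ hY, List.head_append_of_ne_nil hX] at cl ar
  refine ⟨by simp [hX], (isChain_append_iff hY hX).2 ⟨ch.2.1, ch.1, cl⟩, ?_, ?_⟩
  · simpa only [List.getLast_append_of_ne_nil _ hX, List.head_append_of_ne_nil hY] using ch.2.2
  · rw [arcCount_append hY hX]
    simp only [List.getLast_append_of_ne_nil _ hX, List.head_append_of_ne_nil hY]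
    omega

lemma IsCyc.rotated {n : ℕ} {C Q : List V} (h : IsCyc A part n C) (hQ : C ~r Q) :
    IsCyc A part n Q := by
  obtain ⟨k, hk, rfl⟩ := List.isRotated_iff_mod.1 hQ
  rw [List.rotate_eq_drop_append_take hk]
  exact IsCyc.swap (by simpa using h)

lemma exists_rotated_head {C : List V} {c : V} (hc : c ∈ C) :
    ∃ Q, ∃ h : Q ≠ [], C ~r Q ∧ Q.head h = c := by
  obtain ⟨X, Y, rfl⟩ := List.append_of_mem hc
  exact ⟨c :: Y ++ X, by simp, List.isRotated_append, rfl⟩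

lemma exists_rotated_last {C : List V} {c : V} (hc : c ∈ C) :
    ∃ Q, ∃ h : Q ≠ [], C ~r Q ∧ Q.getLast h = c := by
  obtain ⟨X, Y, rfl⟩ := List.append_of_mem hc
  refine ⟨Y ++ (X ++ [c]), by simp, ?_, by simp⟩
  simpa using List.isRotated_append (l := X ++ [c]) (l' := Y)

/-- A G-path and a disjoint G-cycle can be merged into one G-path without losing arcs. -/
lemma exists_merge (hD : IsSMD A part) {n : ℕ} {P C : List V} (hP : P ≠ [])
    (hPc : P.IsChain (Link A part)) (hC : IsCyc A part n C) :
    ∃ L : List V, L.Perm (P ++ C) ∧ L.IsChain (Link A part) ∧ arcCount A P + n ≤ arcCount A L := by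
  by_contra hno
  have front : ∀ Q (hQ : Q ≠ []), C ~r Q → Link A part (Q.getLast hQ) (P.head hP) →
      ind A (Q.getLast hQ) (Q.head hQ) ≤ ind A (Q.getLast hQ) (P.head hP) → False := by
    intro Q hQ hr hl hi
    have hc := hC.rotated hr
    refine hno ⟨Q ++ P, List.perm_append_comm.trans (hr.perm.symm.append_left P),
      (isChain_append_iff hQ hP).2 ⟨hc.chain, hPc, hl⟩, ?_⟩
    have := hc.arcs
    rw [arcCount_append hQ hP]
    omega
  have back : ∀ c ∈ C, ¬ A (P.getLast hP) c := by
    intro c hcC ha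
    obtain ⟨Q, hQ, hr, rfl⟩ := exists_rotated_head hcC
    have hc := hC.rotated hr
    refine hno ⟨P ++ Q, hr.perm.symm.append_left P,
      (isChain_append_iff hP hQ).2 ⟨hPc, hc.chain, .inl ha⟩, ?_⟩
    have := hc.arcs
    have := ind_le_one (A := A) (Q.getLast hQ) (Q.head hQ)
    rw [arcCount_append hP hQ, ind_of_arc ha]
    omega
  have mid : ∀ X Y Q (hX : X ≠ []) (hY : Y ≠ []) (hQ : Q ≠ []), P = X ++ Y → C ~r Q →
      Link A part (X.getLast hX) (Q.head hQ) → Link A part (Q.getLast hQ) (Y.head hY) →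
      ind A (X.getLast hX) (Y.head hY) + ind A (Q.getLast hQ) (Q.head hQ) ≤
        ind A (X.getLast hX) (Q.head hQ) + ind A (Q.getLast hQ) (Y.head hY) → False := by
    rintro X Y Q hX hY hQ rfl hr h1 h2 hi
    have hc := hC.rotated hr
    rw [isChain_append_iff hX hY] at hPc
    have hQY : Q ++ Y ≠ [] := by simp [hQ]
    refine hno ⟨X ++ (Q ++ Y), ?_, (isChain_append_iff hX hQY).2 ⟨hPc.1,
      (isChain_append_iff hQ hY).2 ⟨hc.chain, hPc.2.1, h2⟩, ?_⟩, ?_⟩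
    · rw [List.append_assoc]
      exact (List.perm_append_comm.trans (hr.perm.symm.append_left Y)).append_left X
    · rwa [List.head_append_of_ne_nil hQ]
    · have := hc.arcs
      rw [arcCount_append hX hQY, arcCount_append hQ hY, arcCount_append hX hY,
        List.head_append_of_ne_nil hQ]
      omega
  have front' : ∀ c ∈ C, ¬ A c (P.head hP) := by
    intro c hcC ha
    obtain ⟨Q, hQ, hr, rfl⟩ := exists_rotated_last hcC
    refine front Q hQ hr (.inl ha) ?_
    rw [ind_of_arc ha]
    exact ind_le_one _ _
  have outHead : ∃ c ∈ C, A (P.head hP) c := by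
    by_contra! h
    have same : ∀ c ∈ C, part c = part (P.head hP) := by
      intro c hcC
      by_contra hne
      exact (hD.adj _ _ hne).elim (front' c hcC) (h c hcC)
    refine front C hC.ne (.refl C) (.inr (same _ (List.getLast_mem _))) ?_
    rw [ind_of_not_arc (hD.noInside _ _ ?_)]
    · exact Nat.zero_le _
    · rw [same _ (List.getLast_mem _), same _ (List.head_mem _)]
  obtain ⟨X, x, Y, hY, hPe, hX, hy⟩ : ∃ X x Y, ∃ hY : Y ≠ [], P = X ++ [x] ++ Y ∧
      (∀ p ∈ X ++ [x], ∃ c ∈ C, A p c) ∧ ∀ c ∈ C, ¬ A (Y.head hY) c := by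
    set O : V → Bool := fun p => decide (∃ c ∈ C, A p c) with hO
    have hpe : P.takeWhile O ++ P.dropWhile O = P := List.takeWhile_append_dropWhile
    have h1 : P.takeWhile O ≠ [] := by
      obtain ⟨a, t, rfl⟩ := List.exists_cons_of_ne_nil hP
      have : O a = true := by simpa [hO] using outHead
      simp [this]
    have h2 : P.dropWhile O ≠ [] := by
      intro h
      rw [List.dropWhile_eq_nil_iff] at h
      have := h _ (List.getLast_mem hP)
      simp only [hO, decide_eq_true_eq] at this
      obtain ⟨c, hc, ha⟩ := this
      exact back c hc ha
    refine ⟨(P.takeWhile O).dropLast, (P.takeWhile O).getLast h1, P.dropWhile O, h2, ?_, ?_, ?_⟩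
    · rw [List.dropLast_append_getLast, hpe]
    · rw [List.dropLast_append_getLast]
      intro p hp
      simpa [hO] using List.mem_takeWhile_imp hp
    · intro c hc ha
      have := List.head_dropWhile_not O h2
      simp only [hO, decide_eq_false_iff_not] at this
      exact this ⟨c, hc, ha⟩
  set y := Y.head hY with hyd
  have crit : ∀ Q (hQ : Q ≠ []), C ~r Q → A x (Q.head hQ) →
      part (Q.getLast hQ) = part y ∧ A x y ∧ A (Q.getLast hQ) (Q.head hQ) := by
    intro Q hQ hr ha
    have hm := mid (X ++ [x]) Y Q (by simp) hY hQ hPe hr (.inl (by simpa using ha))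
    simp only [List.getLast_append_singleton, ← hyd, ind_of_arc ha] at hm
    have hlC : Q.getLast hQ ∈ C := hr.perm.mem_iff.2 (List.getLast_mem _)
    have b1 := ind_le_one (A := A) x y
    have b2 := ind_le_one (A := A) (Q.getLast hQ) (Q.head hQ)
    have hp : part (Q.getLast hQ) = part y := by
      by_contra hne
      have ha' := (hD.adj _ _ hne).resolve_right (hy _ hlC)
      rw [ind_of_arc ha'] at hm
      exact hm (.inl ha') (by omega)
    refine ⟨hp, ?_, ?_⟩ <;> by_contra h <;> rw [ind_of_not_arc h] at hm <;>
      exact hm (.inr hp) (by omega)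
  obtain ⟨c₀, hc₀, hxc₀⟩ := hX x (by simp)
  obtain ⟨Q₀, hQ₀, hr₀, rfl⟩ := exists_rotated_head hc₀
  obtain ⟨hl₀, hxy, hla₀⟩ := crit Q₀ hQ₀ hr₀ hxc₀
  have hlC₀ : Q₀.getLast hQ₀ ∈ C := hr₀.perm.mem_iff.2 (List.getLast_mem _)
  have hxW : part x ≠ part y := fun h => hD.noInside _ _ h hxy
  have good : ∀ c ∈ C, part c = part y → ¬ A x c ∧ A c x := by
    intro c hcC hcW
    have h1 : ¬ A x c := by
      intro ha
      obtain ⟨Q, hQ, hr, rfl⟩ := exists_rotated_head hcC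
      obtain ⟨h1, -, h2⟩ := crit Q hQ hr ha
      exact hD.noInside _ _ (h1.trans hcW.symm) h2
    exact ⟨h1, (hD.adj x c (fun h => hxW (h.trans hcW))).resolve_left h1⟩
  have hXne : X ≠ [] := by
    rintro rfl
    refine front' _ hlC₀ ?_
    have : P.head hP = x := by simp [hPe]
    rw [this]
    exact (good _ hlC₀ hl₀).2
  set s := X.getLast hXne with hs
  obtain ⟨c, hcC, hsc⟩ := hX s (List.mem_append_left _ (List.getLast_mem _))
  obtain ⟨Q, hQ, hr, rfl⟩ := exists_rotated_head hcC
  have hlC : Q.getLast hQ ∈ C := hr.perm.mem_iff.2 (List.getLast_mem _)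
  by_cases hW : part (Q.getLast hQ) = part y
  · have ha := (good _ hlC hW).2
    have hm := mid X (x :: Y) Q hXne (by simp) hQ (by simp [hPe]) hr (.inl hsc) (.inl ha)
    simp only [List.head_cons, ← hs, ind_of_arc hsc, ind_of_arc ha] at hm
    have b1 := ind_le_one (A := A) s x
    have b2 := ind_le_one (A := A) (Q.getLast hQ) (Q.head hQ)
    exact hm (by omega)
  · have hly : A (Q.getLast hQ) y := (hD.adj _ _ hW).resolve_right (hy _ hlC)
    obtain ⟨Z₁, Z₂, rfl, rfl⟩ : ∃ Z₁ Z₂, Q₀ = Z₁ ++ Z₂ ∧ Q = Z₂ ++ Z₁ := by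
      obtain ⟨k, hk, rfl⟩ := List.isRotated_iff_mod.1 (hr₀.symm.trans hr)
      exact ⟨Q₀.take k, Q₀.drop k, by simp, List.rotate_eq_drop_append_take hk⟩
    have hZ₁ : Z₁ ≠ [] := by rintro rfl; simp_all
    have hZ₂ : Z₂ ≠ [] := by rintro rfl; simp_all
    have hc := hC.rotated hr₀
    have har := hc.arcs
    have hch := hc.chain
    simp only [List.getLast_append_of_ne_nil _ hZ₁, List.getLast_append_of_ne_nil _ hZ₂,
      List.head_append_of_ne_nil hZ₁, List.head_append_of_ne_nil hZ₂] at *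
    have hZx := (good _ hlC₀ hl₀).2
    rw [arcCount_append hZ₁ hZ₂] at har
    rw [isChain_append_iff hZ₁ hZ₂] at hch
    have hPe' : P = X ++ ([x] ++ Y) := by simp [hPe]
    have n0 : [x] ++ Y ≠ [] := by simp
    rw [hPe', isChain_append_iff hXne n0, isChain_append_iff (by simp) hY] at hPc
    have n1 : Z₁ ++ Y ≠ [] := by simp [hY]
    have n2 : [x] ++ (Z₁ ++ Y) ≠ [] := by simp
    have n3 : Z₂ ++ ([x] ++ (Z₁ ++ Y)) ≠ [] := by simp
    refine hno ⟨X ++ (Z₂ ++ ([x] ++ (Z₁ ++ Y))), ?_, ?_, ?_⟩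
    · refine List.Perm.trans ?_ (hr₀.perm.symm.append_left P)
      rw [hPe, ← Multiset.coe_eq_coe]
      simp only [← Multiset.coe_add]
      abel
    · rw [isChain_append_iff hXne n3, isChain_append_iff hZ₂ n2,
        isChain_append_iff (by simp) n1, isChain_append_iff hZ₁ hY]
      simp only [List.head_append_of_ne_nil hZ₁, List.head_append_of_ne_nil hZ₂]
      exact ⟨hPc.1, ⟨hch.2.1, ⟨by simp, ⟨hch.1, hPc.2.1.2.1, .inl hly⟩, .inl hxc₀⟩, .inl hZx⟩,
        .inl hsc⟩
    · rw [hPe', arcCount_append hXne n0, arcCount_append (by simp) hY,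
        arcCount_append hXne n3, arcCount_append hZ₂ n2,
        arcCount_append (by simp) n1, arcCount_append hZ₁ hY]
      simp only [List.head_append_of_ne_nil hZ₁, List.head_append_of_ne_nil hZ₂,
        List.getLast_singleton, List.singleton_append, List.head_cons, ← hs, ← hyd,
        ind_of_arc hsc, ind_of_arc hZx, ind_of_arc hxc₀, ind_of_arc hly]
      have b1 := ind_le_one (A := A) s x
      have b2 := ind_le_one (A := A) x y
      have b3 := ind_le_one (A := A) (Z₁.getLast hZ₁) (Z₂.head hZ₂)
      have b4 := ind_le_one (A := A) (Z₂.getLast hZ₂) (Z₁.head hZ₁)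
      omega

lemma exists_path_ge (hD : IsSMD A part) (cs : List (GCycle A part)) (P : GPath A part)
    (hc : cs.Pairwise fun C C' => ∀ x ∈ C.toGPath.verts, x ∉ C'.toGPath.verts)
    (hp : ∀ C ∈ cs, ∀ x ∈ P.verts, x ∉ C.toGPath.verts) :
    ∃ Q : GPath A part, P.len + (cs.map GCycle.len).sum ≤ Q.len := by
  induction cs generalizing P with
  | nil => exact ⟨P, by simp⟩
  | cons C cs ih =>
    rw [List.pairwise_cons] at hc
    obtain ⟨L, hperm, hch, hle⟩ := exists_merge (n := C.len) hD P.ne P.chain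
      ⟨C.ne, C.chain, C.close, (GCycle_len_eq C).symm⟩
    have hnd : L.Nodup := hperm.nodup_iff.2
      (P.nodup.append C.nodup fun x hx hx' => hp C (by simp) x hx hx')
    have hne : L ≠ [] := by
      rintro rfl
      simpa [P.ne] using hperm.symm.eq_nil
    obtain ⟨Q, hQ⟩ := ih ⟨L, hne, hnd, hch⟩ hc.2 (by
      intro C' hC' x hx
      rcases List.mem_append.1 (hperm.mem_iff.1 hx) with h | h
      · exact hp C' (by simp [hC']) x h
      · exact hc.1 C' hC' x h)
    refine ⟨Q, le_trans ?_ hQ⟩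
    have : P.len + C.len ≤ GPath.len (A := A) (part := part) ⟨L, hne, hnd, hch⟩ := hle
    simp only [List.map_cons, List.sum_cons]
    omega

lemma GPath_len_le [Fintype V] (P : GPath A part) : P.len ≤ Fintype.card V := by
  refine List.countP_le_length.trans (le_trans ?_ P.nodup.length_le_card)
  simp

end SMD

/-- The maximum number of arcs in a G-path of a semicomplete multipartite
digraph equals the maximum number of arcs in a 1-G-path-G-cycle subdigraph. -/
theorem stmt6 {V K : Type} [Fintype V] [Nonempty V] {A : V → V → Prop} {part : V → K}
    (hSMD : IsSMD A part) :
    ∃ L : ℕ, IsGreatest {n | ∃ P : GPath A part, P.len = n} L ∧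
      IsGreatest {n | ∃ F : GPCS A part, F.arcs = n} L := by
  have hbdd : BddAbove {n | ∃ P : GPath A part, P.len = n} :=
    ⟨Fintype.card V, by rintro _ ⟨P, rfl⟩; exact SMD.GPath_len_le P⟩
  have hne : {n | ∃ P : GPath A part, P.len = n}.Nonempty :=
    ⟨_, ⟨[Classical.arbitrary V], by simp, by simp, List.isChain_singleton _⟩, rfl⟩
  obtain ⟨P, hP⟩ := Nat.sSup_mem hne hbdd
  refine ⟨_, ⟨⟨P, hP⟩, fun n hn => le_csSup hbdd hn⟩,
    ⟨⟨P, [], .nil, by simp⟩, by simpa [GPCS.arcs] using hP⟩, ?_⟩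
  rintro _ ⟨F, rfl⟩
  obtain ⟨Q, hQ⟩ := SMD.exists_path_ge hSMD F.cycles F.path F.disjc F.disjp
  exact hQ.trans (le_csSup hbdd ⟨Q, rfl⟩)
end

section
/- Let D be a semicomplete multipartite digraph with a G-cycle factor C_1^g ∪ C_2^g such that neither C_1^g nor C_2^g has any vertex singular with respect to the other. Then D has a spanning G-cycle with at least ℓ(C_1^g) + ℓ(C_2^g) arcs. -/
open Classical

universe u v

variable {V : Type u} {K : Type v} {A : V → V → Prop} {part : V → K}

/-- The consecutive pairs of a list. -/
def steps (l : List V) : List (V × V) := l.zip l.tail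

/-- The cyclically consecutive pairs of a list. -/
def cyclicSteps (l : List V) : List (V × V) := l.zip (l.rotate 1)

/-- The number of arcs in a list of pairs. -/
noncomputable def arcCount (A : V → V → Prop) (L : List (V × V)) : ℕ :=
  L.countP fun q => decide (A q.1 q.2)

/-- `l` lists the vertices of a G-cycle in cyclic order. -/
structure IsGCycleList (A : V → V → Prop) (part : V → K) (l : List V) : Prop where
  ne : l ≠ []
  nodup : l.Nodup
  ok : ∀ p ∈ cyclicSteps l, A p.1 p.2 ∨ part p.1 = part p.2

/-- The sequence `b` can be inserted between two consecutive vertices of the cyclic list `l`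
using two arcs. -/
def Insertable (A : V → V → Prop) (l b : List V) : Prop :=
  ∃ u u' h t, (u, u') ∈ cyclicSteps l ∧ b.head? = some h ∧ b.getLast? = some t ∧
    A u h ∧ A t u'

/-- There is a spanning G-cycle with at least as many arcs as `l₁` and `l₂` together. -/
def Mergeable (A : V → V → Prop) (part : V → K) (l₁ l₂ : List V) : Prop :=
  ∃ l, IsGCycleList A part l ∧ (∀ v, v ∈ l₁ ∨ v ∈ l₂ → v ∈ l) ∧
    arcCount A (cyclicSteps l₁) + arcCount A (cyclicSteps l₂) ≤ arcCount A (cyclicSteps l)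

theorem Mergeable.symm {l₁ l₂ : List V} (h : Mergeable A part l₁ l₂) :
    Mergeable A part l₂ l₁ := by
  obtain ⟨l, hl, hc, hw⟩ := h
  exact ⟨l, hl, fun v hv => hc v hv.symm, by omega⟩

theorem steps_cons_cons (a b : V) (l : List V) :
    steps (a :: b :: l) = (a, b) :: steps (b :: l) := rfl

theorem steps_append {l₁ l₂ : List V} {t h : V} (h₁ : l₁.getLast? = some t)
    (h₂ : l₂.head? = some h) : steps (l₁ ++ l₂) = steps l₁ ++ (t, h) :: steps l₂ := by
  induction l₁ with
  | nil => simp at h₁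
  | cons a l₁ ih =>
    cases l₁ with
    | nil =>
      cases l₂ with
      | nil => simp at h₂
      | cons b l₂ =>
        simp at h₁ h₂
        subst h₁ h₂
        simp [steps]
    | cons b l₁ =>
      have := ih (by simpa using h₁)
      simp only [List.cons_append, steps_cons_cons] at this ⊢
      rw [this]

theorem cyclicSteps_eq {l : List V} {h t : V} (hh : l.head? = some h)
    (ht : l.getLast? = some t) : cyclicSteps l = steps l ++ [(t, h)] := by
  cases l with
  | nil => simp at hh
  | cons a l =>
    have h₁ := steps_append (l₁ := a :: l) (l₂ := [a]) ht rfl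
    simp only [List.head?_cons, Option.some.injEq] at hh
    subst hh
    have h₂ : cyclicSteps (a :: l) = steps ((a :: l) ++ [a]) := by
      simp only [cyclicSteps, steps, List.rotate_cons_succ, List.rotate_zero, List.cons_append,
        List.tail_cons]
      rw [← List.cons_append]
      conv_rhs => rw [← List.append_nil (l ++ [a])]
      rw [List.zip_append (by simp)]
      simp
    rw [h₂, h₁]
    simp [steps]

theorem cyclicSteps_append {l₁ l₂ : List V} {h₁ t₁ h₂ t₂ : V} (hh₁ : l₁.head? = some h₁)
    (ht₁ : l₁.getLast? = some t₁) (hh₂ : l₂.head? = some h₂) (ht₂ : l₂.getLast? = some t₂) :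
    cyclicSteps (l₁ ++ l₂) = steps l₁ ++ (t₁, h₂) :: (steps l₂ ++ [(t₂, h₁)]) := by
  rw [cyclicSteps_eq (h := h₁) (t := t₂) (by simp [hh₁]) (by simp [ht₂]),
    steps_append ht₁ hh₂]
  simp

theorem cyclicSteps_rotate (l : List V) (k : ℕ) :
    cyclicSteps (l.rotate k) = (cyclicSteps l).rotate k := by
  unfold cyclicSteps
  rw [List.rotate_rotate, Nat.add_comm, ← List.rotate_rotate]
  exact (List.zipWith_rotate_distrib _ _ _ _ (by simp)).symm

theorem cyclicSteps_rotate_perm (l : List V) (k : ℕ) :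
    (cyclicSteps (l.rotate k)).Perm (cyclicSteps l) := by
  rw [cyclicSteps_rotate]
  exact List.rotate_perm _ _

theorem arcCount_append (L M : List (V × V)) :
    arcCount A (L ++ M) = arcCount A L + arcCount A M := List.countP_append

theorem arcCount_cons (p : V × V) (L : List (V × V)) :
    arcCount A (p :: L) = arcCount A L + if A p.1 p.2 then 1 else 0 := by
  simp [arcCount, List.countP_cons]

theorem arcCount_nil : arcCount A ([] : List (V × V)) = 0 := rfl

theorem arcCount_perm {L M : List (V × V)} (h : L.Perm M) : arcCount A L = arcCount A M :=
  h.countP_eq _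

theorem mem_cyclicSteps_getElem {l : List V} {i : ℕ} (hi : i < l.length) :
    (l[i], l[(i + 1) % l.length]'(Nat.mod_lt _ (by omega))) ∈ cyclicSteps l := by
  rw [cyclicSteps, List.mem_iff_getElem]
  exact ⟨i, by simpa using hi, by simp [List.getElem_rotate]⟩

theorem exists_getElem_of_mem_cyclicSteps {l : List V} {u v : V} (h : (u, v) ∈ cyclicSteps l) :
    ∃ i, ∃ hi : i < l.length, l[i] = u ∧ l[(i + 1) % l.length]'(Nat.mod_lt _ (by omega)) = v := by
  rw [cyclicSteps, List.mem_iff_getElem] at h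
  obtain ⟨i, hi, h⟩ := h
  have hi' : i < l.length := by simpa using hi
  refine ⟨i, hi', ?_⟩
  simpa [List.getElem_rotate] using h

/-- A cyclic list may be cut open between any two consecutive vertices. -/
theorem exists_rotate_of_mem_cyclicSteps {l : List V} {u v : V} (h : (u, v) ∈ cyclicSteps l) :
    ∃ k, (l.rotate k).head? = some v ∧ (l.rotate k).getLast? = some u := by
  obtain ⟨i, hi, rfl, rfl⟩ := exists_getElem_of_mem_cyclicSteps h
  refine ⟨i + 1, ?_, ?_⟩
  · rw [List.head?_eq_getElem?, List.getElem?_eq_getElem (by simp; omega)]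
    simp [List.getElem_rotate]
  · rw [List.getLast?_eq_getElem?, List.getElem?_eq_getElem (by simp; omega)]
    simp only [List.getElem_rotate, List.length_rotate, Option.some.injEq]
    congr 1
    rw [show l.length - 1 + (i + 1) = i + l.length by omega, Nat.add_mod_right,
      Nat.mod_eq_of_lt hi]

theorem mem_of_mem_cyclicSteps {l : List V} {u v : V} (h : (u, v) ∈ cyclicSteps l) :
    u ∈ l ∧ v ∈ l := by
  have := List.of_mem_zip h
  simpa using this

theorem exists_mem_cyclicSteps {l : List V} {u : V} (h : u ∈ l) :
    ∃ v, (u, v) ∈ cyclicSteps l := by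
  obtain ⟨i, hi, rfl⟩ := List.getElem_of_mem h
  exact ⟨_, mem_cyclicSteps_getElem hi⟩

theorem steps_subset_cyclicSteps (l : List V) : steps l ⊆ cyclicSteps l := by
  cases l with
  | nil => simp [steps]
  | cons a l =>
    rw [cyclicSteps_eq (h := a) rfl (List.getLast?_eq_some_getLast (List.cons_ne_nil a l))]
    simp

theorem IsGCycleList.rotate {l : List V} (h : IsGCycleList A part l) (k : ℕ) :
    IsGCycleList A part (l.rotate k) where
  ne := by simpa using h.ne
  nodup := by simpa using h.nodup
  ok := fun p hp => h.ok p ((cyclicSteps_rotate_perm l k).mem_iff.1 hp)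

theorem isChain_of_steps {R : V → V → Prop} {l : List V} (h : ∀ p ∈ steps l, R p.1 p.2) :
    l.IsChain R := by
  induction l with
  | nil => simp
  | cons a l ih =>
    cases l with
    | nil => simp
    | cons b l =>
      simp only [steps_cons_cons, List.mem_cons, forall_eq_or_imp] at h
      exact List.isChain_cons_cons.2 ⟨h.1, ih h.2⟩

theorem steps_of_isChain {R : V → V → Prop} {l : List V} (h : l.IsChain R) :
    ∀ p ∈ steps l, R p.1 p.2 := by
  induction l with
  | nil => simp [steps]
  | cons a l ih =>
    cases l with
    | nil => simp [steps]
    | cons b l =>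
      simp only [steps_cons_cons, List.mem_cons, forall_eq_or_imp]
      exact ⟨(List.isChain_cons_cons.1 h).1, ih (List.isChain_cons_cons.1 h).2⟩

theorem GCycle.isGCycleList (C : GCycle A part) : IsGCycleList A part C.toGPath.verts where
  ne := C.ne
  nodup := C.nodup
  ok := by
    rw [cyclicSteps_eq (List.head?_eq_some_head C.ne) (List.getLast?_eq_some_getLast C.ne)]
    intro p hp
    rcases List.mem_append.1 hp with hp | hp
    · exact steps_of_isChain C.chain p hp
    · rw [List.mem_singleton] at hp
      subst hp
      exact C.close

theorem IsGCycleList.exists_gCycle {l : List V} (h : IsGCycleList A part l) :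
    ∃ C : GCycle A part, C.toGPath.verts = l := by
  have hok := h.ok
  rw [cyclicSteps_eq (List.head?_eq_some_head h.ne) (List.getLast?_eq_some_getLast h.ne)] at hok
  exact ⟨{ verts := l
           ne := h.ne
           nodup := h.nodup
           chain := isChain_of_steps fun p hp => hok p (by simp [hp])
           close := hok (_, _) (List.mem_append_right _ (List.mem_singleton.2 rfl)) }, rfl⟩

/-- Insertion of a G-path into a G-cycle. -/
theorem IsGCycleList.append {l b : List V} (hl : IsGCycleList A part l)
    (hnd : (l ++ b).Nodup) (hb : ∀ p ∈ steps b, A p.1 p.2 ∨ part p.1 = part p.2)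
    {u u' h t : V} (hlh : l.head? = some u') (hlt : l.getLast? = some u)
    (hbh : b.head? = some h) (hbt : b.getLast? = some t)
    (h₁ : A u h ∨ part u = part h) (h₂ : A t u' ∨ part t = part u') :
    IsGCycleList A part (l ++ b) where
  ne := by simp [hl.ne]
  nodup := hnd
  ok := by
    rw [cyclicSteps_append hlh hlt hbh hbt]
    intro p hp
    simp only [List.mem_append, List.mem_cons, List.not_mem_nil, or_false] at hp
    rcases hp with hp | rfl | hp | rfl
    · exact hl.ok p (steps_subset_cyclicSteps l hp)
    · exact h₁
    · exact hb p hp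
    · exact h₂

/-- Two disjoint G-cycles can be merged by exchanging the ends of two consecutive pairs if this
does not decrease the number of arcs. -/
theorem mergeable_of_exchange {l₁ l₂ : List V} (hl₁ : IsGCycleList A part l₁)
    (hl₂ : IsGCycleList A part l₂) (hd : l₁.Disjoint l₂) {x x' y y' : V}
    (hx : (x, x') ∈ cyclicSteps l₁) (hy : (y, y') ∈ cyclicSteps l₂)
    (h₁ : A x y' ∨ part x = part y') (h₂ : A y x' ∨ part y = part x')
    (hw : (if A x x' then 1 else 0) + (if A y y' then 1 else 0) ≤
      (if A x y' then 1 else 0) + if A y x' then 1 else 0) :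
    Mergeable A part l₁ l₂ := by
  obtain ⟨i, hi, hi'⟩ := exists_rotate_of_mem_cyclicSteps hx
  obtain ⟨j, hj, hj'⟩ := exists_rotate_of_mem_cyclicSteps hy
  have r₂ := hl₂.rotate j
  refine ⟨l₁.rotate i ++ l₂.rotate j,
    (hl₁.rotate i).append ?_ (fun p hp => r₂.ok p (steps_subset_cyclicSteps _ hp))
      hi hi' hj hj' h₁ h₂, by simp, ?_⟩
  · rw [List.nodup_append']
    refine ⟨by simpa using hl₁.nodup, by simpa using hl₂.nodup, fun v hv hv' => ?_⟩
    exact hd (by simpa using hv) (by simpa using hv')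
  · rw [← arcCount_perm (cyclicSteps_rotate_perm l₁ i),
      ← arcCount_perm (cyclicSteps_rotate_perm l₂ j), cyclicSteps_append hi hi' hj hj',
      cyclicSteps_eq hi hi', cyclicSteps_eq hj hj']
    simp only [arcCount_append, arcCount_cons, arcCount_nil]
    omega

/-- Multi-insertion: a G-path cut into pieces, each insertable into a G-cycle, can be absorbed
by the G-cycle. -/
theorem exists_multi_insertion (k : ℕ) : ∀ (bs : List (List V)) (l : List V), bs.length ≤ k →
    bs ≠ [] → IsGCycleList A part l → (l ++ bs.flatten).Nodup →
    (∀ p ∈ steps bs.flatten, A p.1 p.2 ∨ part p.1 = part p.2) →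
    (∀ b ∈ bs, Insertable A l b) →
    ∃ m, IsGCycleList A part m ∧ (∀ v, v ∈ l ∨ v ∈ bs.flatten → v ∈ m) ∧
      arcCount A (cyclicSteps l) + arcCount A (steps bs.flatten) + 1 ≤
        arcCount A (cyclicSteps m) := by
  induction k with
  | zero =>
    intro bs l hk hne
    exact absurd (List.length_eq_zero_iff.1 (Nat.le_zero.1 hk)) hne
  | succ k ih =>
    intro bs l hk hne hl hnd hok hins
    obtain ⟨b, bs, rfl⟩ := List.exists_cons_of_ne_nil hne
    obtain ⟨u, u', h, t, hu, hbh, hbt, hA₁, hA₂⟩ := hins b (by simp)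
    by_cases hc : ∃ c ∈ bs, ∃ z, c.getLast? = some z ∧ A z u'
    · obtain ⟨c, hcm, z, hz, hzA⟩ := hc
      obtain ⟨pre, post, rfl⟩ := List.append_of_mem hcm
      have hflat : ((b ++ (pre.flatten ++ c)) :: post).flatten =
          (b :: (pre ++ c :: post)).flatten := by simp
      have := ih ((b ++ (pre.flatten ++ c)) :: post) l
        (by simp at hk ⊢; omega) (by simp) hl (by rwa [hflat]) (by rwa [hflat]) ?_
      · rwa [hflat] at this
      · intro d hd
        rcases List.mem_cons.1 hd with rfl | hd
        · exact ⟨u, u', h, z, hu, by simp [hbh], by simp [hz], hA₁, hzA⟩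
        · exact hins d (by simp [hd])
    · push Not at hc
      obtain ⟨i, hi, hi'⟩ := exists_rotate_of_mem_cyclicSteps hu
      simp only [List.flatten_cons] at hnd hok ⊢
      have hndb : (l.rotate i ++ b).Nodup := by
        have : (l ++ b).Nodup := by
          rw [← List.append_assoc] at hnd
          exact (List.nodup_append'.1 hnd).1
        exact (((List.rotate_perm l i).append_right b).nodup_iff).2 this
      have hwl : arcCount A (cyclicSteps l) ≤ arcCount A (steps (l.rotate i)) + 1 := by
        rw [← arcCount_perm (cyclicSteps_rotate_perm l i), cyclicSteps_eq hi hi']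
        simp only [arcCount_append, arcCount_cons, arcCount_nil]
        split_ifs <;> omega
      have hwm : arcCount A (cyclicSteps (l.rotate i ++ b)) =
          arcCount A (steps (l.rotate i)) + arcCount A (steps b) + 2 := by
        rw [cyclicSteps_append hi hi' hbh hbt]
        simp only [arcCount_append, arcCount_cons, arcCount_nil, hA₁, hA₂, if_true]
        omega
      rcases eq_or_ne bs [] with rfl | hbs
      · refine ⟨l.rotate i ++ b, (hl.rotate i).append hndb ?_ hi hi' hbh hbt
          (.inl hA₁) (.inl hA₂), by simp, ?_⟩
        · simpa using hok
        · simp only [List.flatten_nil, List.append_nil]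
          omega
      · have hfne : bs.flatten ≠ [] := by
          obtain ⟨c, bs, rfl⟩ := List.exists_cons_of_ne_nil hbs
          obtain ⟨_, _, h', _, _, hh', _⟩ := hins c (by simp)
          intro hnil
          simp only [List.flatten_cons, List.append_eq_nil_iff] at hnil
          simp [hnil.1] at hh'
        have hst := steps_append hbt (List.head?_eq_some_head hfne)
        have hl' : IsGCycleList A part (l.rotate i ++ b) :=
          (hl.rotate i).append hndb (fun p hp => hok p (by rw [hst]; simp [hp])) hi hi' hbh hbt
            (.inl hA₁) (.inl hA₂)
        obtain ⟨m, hm, hmc, hmw⟩ := ih bs (l.rotate i ++ b) (by simpa using hk) hbs hl'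
          (by
            rw [List.append_assoc]
            exact ((List.rotate_perm l i).append_right _).nodup_iff.2 hnd)
          (fun p hp => hok p (by rw [hst]; simp [hp]))
          (by
            intro c hcm
            obtain ⟨w, w', h', t', hw, hh', ht', hA₁', hA₂'⟩ := hins c (by simp [hcm])
            refine ⟨w, w', h', t', ?_, hh', ht', hA₁', hA₂'⟩
            rw [← (cyclicSteps_rotate_perm l i).mem_iff, cyclicSteps_eq hi hi'] at hw
            rw [cyclicSteps_append hi hi' hbh hbt]
            rcases List.mem_append.1 hw with hw | hw
            · simp [hw]
            · simp only [List.mem_singleton, Prod.mk.injEq] at hw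
              exact absurd (hw.2 ▸ hA₂') (hc c hcm t' ht'))
        refine ⟨m, hm, fun v hv => hmc v ?_, ?_⟩
        · simpa [or_assoc] using hv
        · rw [hst]
          simp only [arcCount_append, arcCount_cons]
          split_ifs <;> omega

/-- The list can be cut into pieces that are insertable into the cyclic list `l`. -/
def Decomposable (A : V → V → Prop) (l b : List V) : Prop :=
  ∃ bs : List (List V), bs.flatten = b ∧ ∀ c ∈ bs, Insertable A l c

theorem Decomposable.cons {l b c : List V} (hb : Insertable A l b) (hc : Decomposable A l c) :
    Decomposable A l (b ++ c) := by
  obtain ⟨bs, rfl, h⟩ := hc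
  exact ⟨b :: bs, by simp, by simpa using ⟨hb, h⟩⟩

theorem decomposable_nil (l : List V) : Decomposable A l [] := ⟨[], by simp⟩

theorem mergeable_of_decomposable {l₁ l₂ : List V} (hl₁ : IsGCycleList A part l₁)
    (hl₂ : IsGCycleList A part l₂) (hd : l₁.Disjoint l₂) (k : ℕ)
    (h : Decomposable A l₂ (l₁.rotate k)) : Mergeable A part l₁ l₂ := by
  obtain ⟨bs, hbs, hins⟩ := h
  have r₁ := hl₁.rotate k
  obtain ⟨m, hm, hmc, hmw⟩ := exists_multi_insertion bs.length bs l₂ le_rfl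
    (by rintro rfl; exact r₁.ne (by simpa using hbs.symm)) hl₂
    (by
      rw [hbs, List.nodup_append']
      refine ⟨hl₂.nodup, r₁.nodup, fun v hv hv' => hd (by simpa using hv') hv⟩)
    (by rw [hbs]; exact fun p hp => r₁.ok p (steps_subset_cyclicSteps _ hp)) hins
  rw [hbs] at hmc hmw
  refine ⟨m, hm, fun v hv => hmc v (by simpa using hv.symm), ?_⟩
  have : arcCount A (cyclicSteps l₁) ≤ arcCount A (steps (l₁.rotate k)) + 1 := by
    rw [← arcCount_perm (cyclicSteps_rotate_perm l₁ k),
      cyclicSteps_eq (List.head?_eq_some_head r₁.ne) (List.getLast?_eq_some_getLast r₁.ne)]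
    simp only [arcCount_append, arcCount_cons, arcCount_nil]
    split_ifs <;> omega
  omega

theorem decomposable_of_last {l b : List V} {z : V} (hz : b.getLast? = some z)
    (hzi : Insertable A l [z])
    (hb : ∀ p ∈ steps b, Insertable A l [p.1] ∨ Insertable A l [p.1, p.2]) :
    Decomposable A l b := by
  induction hn : b.length using Nat.strong_induction_on generalizing b with
  | _ n ih =>
    subst hn
    rcases b with _ | ⟨a, _ | ⟨c, b⟩⟩
    · exact decomposable_nil l
    · simp at hz
      subst hz
      exact (decomposable_nil l).cons hzi
    · simp only [steps_cons_cons, List.mem_cons, forall_eq_or_imp] at hb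
      have hz' : (c :: b).getLast? = some z := by simpa using hz
      rcases hb.1 with h | h
      · exact (ih _ (by simp) hz' hb.2 rfl).cons h
      · cases b with
        | nil => exact (decomposable_nil l).cons h
        | cons d b =>
          simp only [steps_cons_cons, List.mem_cons, forall_eq_or_imp] at hb
          exact (ih (d :: b).length (by simp) (by simpa using hz') hb.2.2 rfl).cons h

theorem decomposable_of_even {l b : List V} (he : Even b.length)
    (hb : ∀ p ∈ steps b, Insertable A l [p.1, p.2]) : Decomposable A l b := by
  induction hn : b.length using Nat.strong_induction_on generalizing b with
  | _ n ih =>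
    subst hn
    rcases b with _ | ⟨a, _ | ⟨c, b⟩⟩
    · exact decomposable_nil l
    · simp at he
    · simp only [steps_cons_cons, List.mem_cons, forall_eq_or_imp] at hb
      refine (ih b.length (by simp) ?_ ?_ rfl).cons hb.1
      · simpa [Nat.even_add_one] using he
      · intro p hp
        refine hb.2 p ?_
        cases b with
        | nil => simp [steps] at hp
        | cons d b => simp [steps_cons_cons, hp]

/-- If a vertex has in- and out-neighbours on the cyclic list `l` but is not insertable there,
then some in-neighbour on `l` is followed by a vertex of its partite set, which in turn is
followed by an out-neighbour or another vertex of its partite set. -/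
theorem exists_run (hSMD : IsSMD A part) {l : List V} {x : V} (hin : ∃ w ∈ l, A w x)
    (hout : ∃ w ∈ l, A x w) (hx : ¬ Insertable A l [x]) :
    ∃ u u' u'', (u, u') ∈ cyclicSteps l ∧ (u', u'') ∈ cyclicSteps l ∧ A u x ∧
      part x = part u' ∧ (A x u'' ∨ part x = part u'') := by
  obtain ⟨_, hw, hwx⟩ := hin
  obtain ⟨_, hz, hxz⟩ := hout
  obtain ⟨a, ha, rfl⟩ := List.getElem_of_mem hw
  obtain ⟨b, hb, rfl⟩ := List.getElem_of_mem hz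
  have hpos : 0 < l.length := by omega
  set c : ℕ → V := fun i => l[i % l.length]'(Nat.mod_lt _ hpos) with hc
  have hstep : ∀ i, (c i, c (i + 1)) ∈ cyclicSteps l := by
    intro i
    have := mem_cyclicSteps_getElem (l := l) (Nat.mod_lt i hpos)
    simpa [hc] using this
  have hex : ∃ r, ∃ a, A (c a) x ∧ A x (c (a + r + 1)) := by
    refine ⟨b + l.length - a - 1, a, ?_, ?_⟩
    · simpa [hc, Nat.mod_eq_of_lt ha] using hwx
    · rw [show a + (b + l.length - a - 1) + 1 = b + l.length by omega]
      simpa [hc, Nat.mod_eq_of_lt hb] using hxz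
  obtain ⟨a, h₁, h₂⟩ := Nat.find_spec hex
  have hmin := fun r (hr : r < Nat.find hex) => Nat.find_min hex hr
  set r := Nat.find hex
  have hr : r ≠ 0 := by
    intro h0
    rw [h0] at h₂
    exact hx ⟨_, _, x, x, hstep a, rfl, rfl, h₁, h₂⟩
  have hmid : ∀ i, i < r → part x = part (c (a + i + 1)) := by
    intro i hi
    by_contra hne
    rcases hSMD.adj _ _ hne with h | h
    · exact hmin i hi ⟨a, h₁, h⟩
    · refine hmin (r - i - 1) (by omega) ⟨a + i + 1, h, ?_⟩
      rwa [show a + i + 1 + (r - i - 1) + 1 = a + r + 1 by omega]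
  refine ⟨c a, c (a + 1), c (a + 1 + 1), hstep a, hstep _, h₁, hmid 0 (by omega), ?_⟩
  by_cases h : r = 1
  · rw [h] at h₂
    exact .inl h₂
  · exact .inr (hmid 1 (by omega))

/-- A non-insertable vertex of one of two non-mergeable G-cycles forms, together with its
successor, an insertable pair. -/
theorem exists_pair_insertion (hSMD : IsSMD A part) {l₁ l₂ : List V}
    (hl₁ : IsGCycleList A part l₁) (hl₂ : IsGCycleList A part l₂) (hd : l₁.Disjoint l₂)
    (hno : ¬ Mergeable A part l₁ l₂) {x x' : V} (hxx' : (x, x') ∈ cyclicSteps l₁)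
    (hin : ∃ w ∈ l₂, A w x) (hout : ∃ w ∈ l₂, A x w) (hx : ¬ Insertable A l₂ [x]) :
    ∃ u u', (u, u') ∈ cyclicSteps l₂ ∧ A u x ∧ part x = part u' ∧ part x ≠ part x' ∧
      A x' u' := by
  obtain ⟨u, u', u'', h₁, h₂, hux, hp, hx''⟩ := exists_run hSMD hin hout hx
  have hno' : ¬ (A u' x' ∨ part u' = part x') := by
    intro h
    refine hno (mergeable_of_exchange hl₁ hl₂ hd hxx' h₂ hx'' h ?_)
    have e₁ : part u' = part x' → ¬ A x x' := fun h => hSMD.noInside _ _ (hp.trans h)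
    have e₂ : part x = part u'' → ¬ A u' u'' := fun h => hSMD.noInside _ _ (hp.symm.trans h)
    rcases h with h | h <;> rcases hx'' with h' | h'
    · rw [if_pos h, if_pos h']
      split_ifs <;> omega
    · rw [if_pos h, if_neg (e₂ h')]
      split_ifs <;> omega
    · rw [if_pos h', if_neg (e₁ h)]
      split_ifs <;> omega
    · rw [if_neg (e₁ h), if_neg (e₂ h')]
      omega
  push Not at hno'
  have hne : part x ≠ part x' := by rw [hp]; exact hno'.2
  exact ⟨u, u', h₁, hux, hp, hne, (hSMD.adj _ _ hno'.2).resolve_left hno'.1⟩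

/-- Two disjoint G-cycles can be merged if each vertex of the first one has in- and
out-neighbours on the second one, and some vertex of the first one is insertable into the
second one. -/
theorem mergeable_of_insertable (hSMD : IsSMD A part) {l₁ l₂ : List V}
    (hl₁ : IsGCycleList A part l₁) (hl₂ : IsGCycleList A part l₂) (hd : l₁.Disjoint l₂)
    (hin : ∀ x ∈ l₁, ∃ w ∈ l₂, A w x) (hout : ∀ x ∈ l₁, ∃ w ∈ l₂, A x w)
    {x : V} (hx : x ∈ l₁) (hxi : Insertable A l₂ [x]) : Mergeable A part l₁ l₂ := by
  by_contra hno
  obtain ⟨x', hx'⟩ := exists_mem_cyclicSteps hx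
  obtain ⟨k, -, hk⟩ := exists_rotate_of_mem_cyclicSteps hx'
  refine hno (mergeable_of_decomposable hl₁ hl₂ hd k (decomposable_of_last hk hxi ?_))
  intro p hp
  have hp' := (cyclicSteps_rotate_perm l₁ k).mem_iff.1 (steps_subset_cyclicSteps _ hp)
  have hm := (mem_of_mem_cyclicSteps hp').1
  by_cases hpi : Insertable A l₂ [p.1]
  · exact .inl hpi
  · obtain ⟨u, u', h, hA, -, -, hA'⟩ := exists_pair_insertion hSMD hl₁ hl₂ hd hno hp'
      (hin _ hm) (hout _ hm) hpi
    exact .inr ⟨u, u', p.1, p.2, h, rfl, rfl, hA, hA'⟩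

theorem mergeable_of_nonsingular (hSMD : IsSMD A part) {l₁ l₂ : List V}
    (hl₁ : IsGCycleList A part l₁) (hl₂ : IsGCycleList A part l₂) (hd : l₁.Disjoint l₂)
    (hin₁ : ∀ x ∈ l₁, ∃ w ∈ l₂, A w x) (hout₁ : ∀ x ∈ l₁, ∃ w ∈ l₂, A x w)
    (hin₂ : ∀ x ∈ l₂, ∃ w ∈ l₁, A w x) (hout₂ : ∀ x ∈ l₂, ∃ w ∈ l₁, A x w) :
    Mergeable A part l₁ l₂ := by
  by_contra hno
  have hi₁ : ∀ x ∈ l₁, ¬ Insertable A l₂ [x] := fun x hx hxi =>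
    hno (mergeable_of_insertable hSMD hl₁ hl₂ hd hin₁ hout₁ hx hxi)
  have hi₂ : ∀ x ∈ l₂, ¬ Insertable A l₁ [x] := fun x hx hxi =>
    hno (mergeable_of_insertable hSMD hl₂ hl₁ hd.symm hin₂ hout₂ hx hxi).symm
  have hpair : ∀ x x', (x, x') ∈ cyclicSteps l₁ → ∃ u u', (u, u') ∈ cyclicSteps l₂ ∧ A u x ∧
      part x = part u' ∧ part x ≠ part x' ∧ A x' u' := by
    intro x x' h
    have hx := (mem_of_mem_cyclicSteps h).1
    exact exists_pair_insertion hSMD hl₁ hl₂ hd hno h (hin₁ x hx) (hout₁ x hx) (hi₁ x hx)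
  have hpair' : ∀ p ∈ cyclicSteps l₁, Insertable A l₂ [p.1, p.2] := by
    intro p hp
    obtain ⟨u, u', h, hA, -, -, hA'⟩ := hpair p.1 p.2 hp
    exact ⟨u, u', p.1, p.2, h, rfl, rfl, hA, hA'⟩
  have hodd : ¬ Even l₁.length := by
    intro he
    refine hno (mergeable_of_decomposable hl₁ hl₂ hd 0 (decomposable_of_even (by simpa) ?_))
    intro p hp
    exact hpair' p (by simpa using steps_subset_cyclicSteps _ hp)
  have hpos : 0 < l₁.length := List.length_pos_iff.2 hl₁.ne
  set c : ℕ → V := fun i => l₁[i % l₁.length]'(Nat.mod_lt _ hpos) with hc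
  have hstep : ∀ i, (c i, c (i + 1)) ∈ cyclicSteps l₁ := by
    intro i
    have := mem_cyclicSteps_getElem (l := l₁) (Nat.mod_lt i hpos)
    simpa [hc] using this
  have htwo : ∀ k, part (c k) = part (c (k + 2)) := by
    intro k
    obtain ⟨u, u', h, hA, hp, hne, hA'⟩ := hpair _ _ (hstep k)
    by_contra hcon
    rw [hp] at hcon
    rcases hSMD.adj _ _ hcon with h' | h'
    · exact hi₂ u' (mem_of_mem_cyclicSteps h).2
        ⟨c (k + 1), c (k + 2), u', u', hstep (k + 1), rfl, rfl, hA', h'⟩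
    · have hget : ∀ j (hj : j < (l₁.rotate k).length), (l₁.rotate k)[j] = c (k + j) := by
        intro j hj
        simp [hc, List.getElem_rotate, Nat.add_comm]
      have hlen : (l₁.rotate k).length = l₁.length := by simp
      have hsub : ∀ p ∈ steps (l₁.rotate k), Insertable A l₂ [p.1, p.2] := fun p hp =>
        hpair' p ((cyclicSteps_rotate_perm l₁ k).mem_iff.1 (steps_subset_cyclicSteps _ hp))
      refine hno (mergeable_of_decomposable hl₁ hl₂ hd k ?_)
      rcases hm : l₁.rotate k with _ | ⟨p, _ | ⟨q, _ | ⟨s, m⟩⟩⟩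
      · simp [hl₁.ne] at hm
      · rw [hm] at hlen
        exact absurd (by simp [hc, ← hlen, Nat.mod_one]) hne
      · rw [hm] at hlen
        exact absurd (by simp [← hlen]) hodd
      · have e₀ := hget 0 (by simp [hm])
        have e₂ := hget 2 (by simp [hm])
        simp only [hm, List.getElem_cons_zero, List.getElem_cons_succ, Nat.add_zero] at e₀ e₂
        subst e₀ e₂
        rw [hm] at hlen hsub
        refine Decomposable.cons (b := [c k, q, c (k + 2)]) (c := m)
          ⟨u, u', _, _, h, rfl, rfl, hA, h'⟩ (decomposable_of_even ?_ fun p hp => hsub p ?_)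
        · rw [← hlen] at hodd
          simpa [Nat.even_add_one] using hodd
        · cases m with
          | nil => simp [steps] at hp
          | cons d m => simp [steps_cons_cons, hp]
  have hev : ∀ j, part (c 0) = part (c (2 * j)) := by
    intro j
    induction j with
    | zero => rfl
    | succ j ih => rw [ih, htwo (2 * j), Nat.mul_succ]
  obtain ⟨j, hj⟩ := Nat.not_even_iff_odd.1 hodd
  obtain ⟨-, -, -, -, -, hne, -⟩ := hpair _ _ (hstep 0)
  apply hne
  rw [hev (j + 1), show 2 * (j + 1) = 0 + 1 + l₁.length by omega]
  simp [hc]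

theorem GCycle.exists_in_of_not_singularWrt (hSMD : IsSMD A part) {C : GCycle A part} {v : V}
    (h : ¬ C.SingularWrt v) : ∃ w ∈ C.toGPath.verts, A w v := by
  by_contra! hcon
  exact h (.inl fun w hw => ⟨fun hne => (hSMD.adj _ _ hne).resolve_right (hcon w hw), hcon w hw⟩)

theorem GCycle.exists_out_of_not_singularWrt (hSMD : IsSMD A part) {C : GCycle A part} {v : V}
    (h : ¬ C.SingularWrt v) : ∃ w ∈ C.toGPath.verts, A v w := by
  by_contra! hcon
  exact h (.inr fun w hw => ⟨fun hne => (hSMD.adj _ _ hne).resolve_left (hcon w hw), hcon w hw⟩)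

/-- If `C₁ ∪ C₂` is a G-cycle factor such that neither G-cycle has a
vertex singular with respect to the other, then there is a spanning G-cycle with at
least `ℓ(C₁) + ℓ(C₂)` arcs. -/
theorem stmt11 {V K : Type} [Fintype V] {A : V → V → Prop} {part : V → K}
    (hSMD : IsSMD A part) (C₁ C₂ : GCycle A part)
    (hdisj : ∀ x ∈ C₁.toGPath.verts, x ∉ C₂.toGPath.verts)
    (hcover : ∀ v : V, v ∈ C₁.toGPath.verts ∨ v ∈ C₂.toGPath.verts)
    (h1 : ∀ v ∈ C₁.toGPath.verts, ¬ C₂.SingularWrt v)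
    (h2 : ∀ v ∈ C₂.toGPath.verts, ¬ C₁.SingularWrt v) :
    ∃ C : GCycle A part, (∀ v : V, v ∈ C.toGPath.verts) ∧ C₁.len + C₂.len ≤ C.len := by
  obtain ⟨l, hl, hc, hw⟩ := mergeable_of_nonsingular hSMD C₁.isGCycleList C₂.isGCycleList
    (fun x hx => hdisj x hx)
    (fun x hx => GCycle.exists_in_of_not_singularWrt hSMD (h1 x hx))
    (fun x hx => GCycle.exists_out_of_not_singularWrt hSMD (h1 x hx))
    (fun x hx => GCycle.exists_in_of_not_singularWrt hSMD (h2 x hx))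
    (fun x hx => GCycle.exists_out_of_not_singularWrt hSMD (h2 x hx))
  obtain ⟨C, rfl⟩ := hl.exists_gCycle
  exact ⟨C, fun v => hc v (hcover v), hw⟩
end

section
/- Let D be a semicomplete multipartite digraph and let C_1^g, C_2^g be vertex-disjoint G-cycles with C_1^g ≃> C_2^g such that there is no G-cycle in D with vertex set V(C_1^g) ∪ V(C_2^g) and at least ℓ(C_1^g) + ℓ(C_2^g) arcs. If C_i^g has a pair of consecutive vertices u, u^+ belonging to the same partite set V, then C_{3-i}^g contains no vertex from V. -/
open Classical

universe u v

variable {V : Type u} {K : Type v} {A : V → V → Prop} {part : V → K}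

/-- A step from `a` to `b` of weight `w`: an arc (weight one) or a pair of vertices of the
same partite set (weight zero). -/
def Link (A : V → V → Prop) (part : V → K) (a b : V) (w : ℕ) : Prop :=
  (w = 1 ∧ A a b) ∨ (w = 0 ∧ part a = part b)

/-- `Seg A part a b l n`: the list `l` is a sequence of steps from `a` to `b` of total
weight `n`. -/
inductive Seg (A : V → V → Prop) (part : V → K) : V → V → List V → ℕ → Prop
  | single (a : V) : Seg A part a a [a] 0
  | cons {a b c : V} {l : List V} {w n : ℕ} :
      Link A part a b w → Seg A part b c l n → Seg A part a c (a :: l) (w + n)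

/-- The closed sequence on the vertices `L` of weight `N` contains the step `(x, y)`, of
weight `w`. -/
def OpenedAt (A : V → V → Prop) (part : V → K) (L : List V) (N : ℕ) (x y : V) (w : ℕ) : Prop :=
  ∃ l n, Seg A part y x l n ∧ Link A part x y w ∧ n + w = N ∧ l.Perm L

theorem Link.reverse {a b : V} {w : ℕ} (h : Link A part a b w) :
    Link (fun x y => A y x) part b a w := by
  rcases h with h | h
  · exact Or.inl h
  · exact Or.inr ⟨h.1, h.2.symm⟩

theorem Link.of_or {a b : V} (h : A a b ∨ part a = part b) : ∃ w, Link A part a b w := by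
  rcases h with h | h
  · exact ⟨1, Or.inl ⟨rfl, h⟩⟩
  · exact ⟨0, Or.inr ⟨rfl, h⟩⟩

theorem Link.weight_eq (hA : IsSMD A part) {a b : V} {w : ℕ} (h : Link A part a b w) :
    w = if A a b then 1 else 0 := by
  rcases h with h | h
  · simp [h.1, h.2]
  · simp [h.1, hA.noInside _ _ h.2]

theorem Seg.append {a b c d : V} {l m : List V} {n k w : ℕ} (h : Seg A part a b l n)
    (hl : Link A part b c w) (h' : Seg A part c d m k) :
    Seg A part a d (l ++ m) (n + w + k) := by
  induction h with
  | single a => simpa using Seg.cons hl h'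
  | cons h1 _ ih =>
    have := Seg.cons h1 (ih hl)
    simpa [add_assoc] using this

theorem Seg.reverse {a b : V} {l : List V} {n : ℕ} (h : Seg A part a b l n) :
    Seg (fun x y => A y x) part b a l.reverse n := by
  induction h with
  | single a => exact Seg.single a
  | cons h1 _ ih =>
    have := ih.append h1.reverse (Seg.single _)
    rw [List.reverse_cons]
    convert this using 1
    omega

theorem Seg.eq_cons {a b : V} {l : List V} {n : ℕ} (h : Seg A part a b l n) :
    ∃ t, l = a :: t := by
  cases h <;> simp

theorem Seg.getLast_eq {a b : V} {l : List V} {n : ℕ} (h : Seg A part a b l n) (hl : l ≠ []) :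
    l.getLast hl = b := by
  induction h with
  | single a => rfl
  | cons _ h' ih =>
    obtain ⟨t, rfl⟩ := h'.eq_cons
    simpa using ih (by simp)

theorem Seg.isChain {a b : V} {l : List V} {n : ℕ} (h : Seg A part a b l n) :
    l.IsChain fun a b => A a b ∨ part a = part b := by
  induction h with
  | single a => simp
  | cons h1 h' ih =>
    obtain ⟨t, rfl⟩ := h'.eq_cons
    refine List.isChain_cons_cons.2 ⟨?_, ih⟩
    rcases h1 with h1 | h1
    · exact Or.inl h1.2
    · exact Or.inr h1.2

theorem Seg.countP_zip (hA : IsSMD A part) {a b : V} {l : List V} {n : ℕ}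
    (h : Seg A part a b l n) (c : V) :
    (l.zip (l.tail ++ [c])).countP (fun q => decide (A q.1 q.2)) =
      n + if A b c then 1 else 0 := by
  induction h with
  | single a => simp [List.countP_cons]
  | cons h1 h' ih =>
    have hw := h1.weight_eq hA
    obtain ⟨t, rfl⟩ := h'.eq_cons
    simp only [List.tail_cons, List.cons_append, List.zip_cons_cons, List.countP_cons,
      decide_eq_true_eq] at ih ⊢
    rw [ih]
    omega

theorem Seg.exists_of_isChain {l : List V} (hl : l ≠ [])
    (h : l.IsChain fun a b => A a b ∨ part a = part b) :
    ∃ n, Seg A part (l.head hl) (l.getLast hl) l n := by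
  induction l with
  | nil => exact absurd rfl hl
  | cons a t ih =>
    cases t with
    | nil => exact ⟨0, Seg.single a⟩
    | cons b t =>
      rw [List.isChain_cons_cons] at h
      obtain ⟨n, hn⟩ := ih (by simp) h.2
      obtain ⟨w, hw⟩ := Link.of_or h.1
      exact ⟨w + n, Seg.cons hw (by simpa using hn)⟩

theorem Seg.split_of_mem_zip {a b c x y : V} {l : List V} {n : ℕ} (h : Seg A part a b l n)
    (hx : (x, y) ∈ l.zip (l.tail ++ [c])) :
    (x = b ∧ y = c) ∨ ∃ l₁ l₂ n₁ n₂ w, Seg A part a x l₁ n₁ ∧ Link A part x y w ∧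
      Seg A part y b l₂ n₂ ∧ l = l₁ ++ l₂ ∧ n = n₁ + w + n₂ := by
  induction h with
  | single a => exact Or.inl (by simpa using hx)
  | @cons a a' b l w n h1 h' ih =>
    obtain ⟨t, rfl⟩ := h'.eq_cons
    simp only [List.tail_cons, List.cons_append, List.zip_cons_cons, List.mem_cons] at hx ih
    rcases hx with hx | hx
    · obtain ⟨rfl, rfl⟩ := Prod.mk.inj hx
      exact Or.inr ⟨[x], y :: t, 0, n, w, Seg.single x, h1, h', rfl, by omega⟩
    · rcases ih (by simpa using hx) with ih | ⟨l₁, l₂, n₁, n₂, w', h₁, h₂, h₃, h₄, h₅⟩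
      · exact Or.inl ih
      · exact Or.inr ⟨a :: l₁, l₂, w + n₁, n₂, w', Seg.cons h1 h₁, h₂, h₃, by simp [h₄],
          by omega⟩

theorem Seg.split_of_mem {a b x : V} {l : List V} {n : ℕ} (h : Seg A part a b l n)
    (hx : x ∈ l) (hne : x ≠ b) :
    ∃ y l₁ l₂ n₁ n₂ w, Seg A part a x l₁ n₁ ∧ Link A part x y w ∧
      Seg A part y b l₂ n₂ ∧ l = l₁ ++ l₂ ∧ n = n₁ + w + n₂ := by
  induction h with
  | single a => simp_all
  | @cons a a' b l w n h1 h' ih =>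
    by_cases hxa : x = a
    · subst hxa
      exact ⟨a', [x], l, 0, n, w, Seg.single x, h1, h', rfl, by omega⟩
    · obtain ⟨y, l₁, l₂, n₁, n₂, w', h₁, h₂, h₃, h₄, h₅⟩ :=
        ih (by simpa [hxa] using hx) hne
      exact ⟨y, a :: l₁, l₂, w + n₁, n₂, w', Seg.cons h1 h₁, h₂, h₃, by simp [h₄], by omega⟩

theorem Seg.split_last {P : V → Prop} {a b : V} {l : List V} {n : ℕ} (h : Seg A part a b l n)
    (hP : ∃ x ∈ l, P x) (hb : ¬ P b) :
    ∃ x y l₁ l₂ n₁ n₂ w, Seg A part a x l₁ n₁ ∧ Link A part x y w ∧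
      Seg A part y b l₂ n₂ ∧ l = l₁ ++ l₂ ∧ n = n₁ + w + n₂ ∧ P x ∧ ∀ z ∈ l₂, ¬ P z := by
  induction h with
  | single a => simp_all
  | @cons a a' b l w n h1 h' ih =>
    by_cases hl : ∃ x ∈ l, P x
    · obtain ⟨x, y, l₁, l₂, n₁, n₂, w', h₁, h₂, h₃, h₄, h₅, h₆⟩ := ih hl hb
      exact ⟨x, y, a :: l₁, l₂, w + n₁, n₂, w', Seg.cons h1 h₁, h₂, h₃, by simp [h₄],
        by omega, h₆⟩
    · obtain ⟨x, hx, hPx⟩ := hP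
      have hxa : x = a := (List.mem_cons.1 hx).resolve_right fun hx => hl ⟨x, hx, hPx⟩
      subst hxa
      exact ⟨x, a', [x], l, 0, n, w, Seg.single x, h1, h', rfl, by omega, hPx,
        fun z hz hPz => hl ⟨z, hz, hPz⟩⟩

theorem OpenedAt.of_split {L l₁ l₂ : List V} {a b x y : V} {N n₁ n₂ v w : ℕ}
    (h₁ : Seg A part a x l₁ n₁) (hxy : Link A part x y w) (h₂ : Seg A part y b l₂ n₂)
    (hba : Link A part b a v) (hN : n₁ + w + n₂ + v = N) (hL : (l₁ ++ l₂).Perm L) :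
    OpenedAt A part L N x y w :=
  ⟨l₂ ++ l₁, _, h₂.append hba h₁, hxy, by omega, List.perm_append_comm.trans hL⟩

theorem OpenedAt.exists_of_mem {L : List V} {N v : ℕ} {a b x : V}
    (h : OpenedAt A part L N b a v) (hx : x ∈ L) : ∃ y w, OpenedAt A part L N x y w := by
  by_cases hxb : x = b
  · subst hxb
    exact ⟨a, v, h⟩
  · obtain ⟨l, n, hs, hl, hn, hp⟩ := h
    obtain ⟨y, l₁, l₂, n₁, n₂, w, h₁, h₂, h₃, rfl, h₅⟩ := hs.split_of_mem (hp.mem_iff.2 hx) hxb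
    exact ⟨y, w, OpenedAt.of_split h₁ h₂ h₃ hl (by omega) hp⟩

theorem OpenedAt.reverse {L : List V} {N w : ℕ} {x y : V} (h : OpenedAt A part L N x y w) :
    OpenedAt (fun x y => A y x) part L N y x w := by
  obtain ⟨l, n, hs, hl, hn, hp⟩ := h
  exact ⟨l.reverse, n, hs.reverse, hl.reverse, hn, l.reverse_perm.trans hp⟩

theorem OpenedAt.right_mem {L : List V} {N w : ℕ} {x y : V} (h : OpenedAt A part L N x y w) :
    y ∈ L := by
  obtain ⟨l, n, hs, -, -, hp⟩ := h
  obtain ⟨t, rfl⟩ := hs.eq_cons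
  exact hp.mem_iff.1 (by simp)

theorem IsSMD.reverse (hA : IsSMD A part) : IsSMD (fun x y => A y x) part :=
  ⟨fun x y h => hA.noInside y x h.symm, fun x y h => hA.adj y x (Ne.symm h)⟩

theorem rotate_one_eq {l : List V} (hl : l ≠ []) : l.rotate 1 = l.tail ++ [l.head hl] := by
  cases l with
  | nil => exact absurd rfl hl
  | cons a t => simp

theorem GCycle.exists_openedAt (hA : IsSMD A part) (C : GCycle A part) :
    ∃ w, OpenedAt A part C.verts C.len (C.verts.getLast C.ne) (C.verts.head C.ne) w := by
  obtain ⟨n, hn⟩ := Seg.exists_of_isChain C.ne C.chain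
  obtain ⟨w, hw⟩ := Link.of_or C.close
  refine ⟨w, C.verts, n, hn, hw, ?_, List.Perm.refl _⟩
  rw [GCycle.len, rotate_one_eq C.ne, hn.countP_zip hA, hw.weight_eq hA]

theorem GCycle.openedAt_of_consec (hA : IsSMD A part) (C : GCycle A part) {x y : V}
    (h : C.consec x y) : ∃ w, OpenedAt A part C.verts C.len x y w := by
  obtain ⟨n, hn⟩ := Seg.exists_of_isChain C.ne C.chain
  obtain ⟨v, hv⟩ := Link.of_or C.close
  have hN : n + v = C.len := by
    rw [GCycle.len, rotate_one_eq C.ne, hn.countP_zip hA, hv.weight_eq hA]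
  rw [GCycle.consec, rotate_one_eq C.ne] at h
  rcases hn.split_of_mem_zip h with ⟨rfl, rfl⟩ | ⟨l₁, l₂, n₁, n₂, w, h₁, h₂, h₃, h₄, h₅⟩
  · exact ⟨v, C.verts, n, hn, hv, hN, List.Perm.refl _⟩
  · exact ⟨w, OpenedAt.of_split h₁ h₂ h₃ hv (by omega) (h₄ ▸ List.Perm.refl _)⟩

theorem GCycle.exists_of_seg (hA : IsSMD A part) {a b : V} {l : List V} {n w : ℕ}
    (h : Seg A part a b l n) (hl : Link A part b a w) (hnd : l.Nodup) :
    ∃ C : GCycle A part, C.verts = l ∧ C.len = n + w := by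
  obtain ⟨t, rfl⟩ := h.eq_cons
  have hcl : A b a ∨ part b = part a := by
    rcases hl with hl | hl
    · exact Or.inl hl.2
    · exact Or.inr hl.2
  refine ⟨⟨⟨a :: t, by simp, hnd, h.isChain⟩, ?_⟩, rfl, ?_⟩
  · rw [h.getLast_eq]
    exact hcl
  · rw [GCycle.len, rotate_one_eq (by simp), h.countP_zip hA, hl.weight_eq hA]
    rfl

/-- If two closed sequences cannot be merged without losing weight, and a vertex of the first
receives no arc from the second, then a weight-zero step of the first excludes its partite set
from the second. -/
theorem part_ne_of_no_merge (hA : IsSMD A part) {L₁ L₂ : List V} {N₁ N₂ : ℕ} {u u' : V}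
    (h₁ : OpenedAt A part L₁ N₁ u u' 0)
    (h₂ : ∀ y ∈ L₂, ∃ y' w, OpenedAt A part L₂ N₂ y y' w)
    (hno : ∀ a b l n w, Seg A part a b l n → Link A part b a w → l.Perm (L₁ ++ L₂) →
      n + w < N₁ + N₂)
    (hdom : ∃ s ∈ L₁, ∀ y ∈ L₂, ¬ A y s) :
    ∀ w ∈ L₂, part w ≠ part u := by
  have merge : ∀ {x x' y y' : V} {a b c d : ℕ}, OpenedAt A part L₁ N₁ x x' c →
      OpenedAt A part L₂ N₂ y y' d → Link A part x y' a → Link A part y x' b →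
      a + b < c + d := by
    rintro x x' y y' a b c d ⟨l, n, hs, hl, hn, hp⟩ ⟨m, k, ht, hm, hk, hq⟩ hxy hyx
    have := hno _ _ _ _ _ (hs.append hxy ht) hyx (hp.append hq)
    omega
  have le_one : ∀ {x y : V} {c : ℕ}, Link A part x y c → c ≤ 1 := by
    rintro x y c (h | h) <;> omega
  have arc_of_one : ∀ {x y : V} {c : ℕ}, Link A part x y c → 1 ≤ c → A x y := by
    rintro x y c (h | h) hc
    · exact h.2
    · omega
  have arc : ∀ {x y : V}, A x y → Link A part x y 1 := fun h => Or.inl ⟨rfl, h⟩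
  have link_of : ∀ {L : List V} {N : ℕ} {x y : V} {c : ℕ}, OpenedAt A part L N x y c →
      Link A part x y c := by
    rintro L N x y c ⟨l, n, -, hl, -⟩
    exact hl
  -- an arc entering the successor of a vertex that receives no arcs
  have enter : ∀ {x₀ x₁ y y' : V} {c d : ℕ}, OpenedAt A part L₁ N₁ x₀ x₁ c →
      (∀ y ∈ L₂, ¬ A y x₀) → OpenedAt A part L₂ N₂ y y' d → A y x₁ →
      part y' = part x₀ ∧ A x₀ x₁ ∧ A y y' := by
    intro x₀ x₁ y y' c d hx h0 hy hyx
    have hc := le_one (link_of hx)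
    have hd := le_one (link_of hy)
    have hp : part y' = part x₀ := by
      by_contra hp
      have := merge hx hy (arc ((hA.adj _ _ hp).resolve_left (h0 _ hy.right_mem))) (arc hyx)
      omega
    have := merge hx hy (Or.inr ⟨rfl, hp.symm⟩) (arc hyx)
    exact ⟨hp, arc_of_one (link_of hx) (by omega), arc_of_one (link_of hy) (by omega)⟩
  have not_enter : ∀ {x₀ x₁ y : V} {c : ℕ}, OpenedAt A part L₁ N₁ x₀ x₁ c →
      (∀ y ∈ L₂, ¬ A y x₀) → y ∈ L₂ → part y = part x₀ → ¬ A y x₁ := by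
    intro x₀ x₁ y c hx h0 hy hp hyx
    obtain ⟨y', d, hy'⟩ := h₂ y hy
    obtain ⟨hp', -, hyy⟩ := enter hx h0 hy' hyx
    exact hA.noInside _ _ (hp.trans hp'.symm) hyy
  have leave : ∀ {x₀ x₁ y y' : V} {c d : ℕ}, OpenedAt A part L₁ N₁ x₀ x₁ c →
      (∀ y ∈ L₂, ¬ A y x₀) → OpenedAt A part L₂ N₂ y y' d → A y x₁ → A x₁ y' := by
    intro x₀ x₁ y y' c d hx h0 hy hyx
    obtain ⟨hp, hxx, hyy⟩ := enter hx h0 hy hyx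
    refine (hA.adj x₁ y' fun h => hA.noInside _ _ (hp.symm.trans h.symm) hxx).resolve_right ?_
    exact not_enter hx h0 hy.right_mem hp
  intro w hw hwu
  obtain ⟨w', d, hww⟩ := h₂ w hw
  have huu : part u = part u' := by
    rcases link_of h₁ with h | h
    · omega
    · exact h.2
  have hd := le_one (link_of hww)
  have hAw : A w w' := by
    rcases link_of hww with h | h
    · exact h.2
    · have := merge h₁ hww (Or.inr ⟨rfl, hwu.symm.trans h.2⟩) (Or.inr ⟨rfl, hwu.trans huu⟩)
      omega
  have hpw : part w' ≠ part u := fun h => hA.noInside _ _ (hwu.trans h.symm) hAw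
  have hw'u : A w' u := by
    refine (hA.adj _ _ hpw).resolve_right fun h => ?_
    have := merge h₁ hww (arc h) (Or.inr ⟨rfl, hwu.trans huu⟩)
    omega
  obtain ⟨l, n, hs, hl, hn, hp⟩ := h₁
  obtain ⟨s, hsL, hsdom⟩ := hdom
  obtain ⟨x₀, x₁, l₁, l₂, n₁, n₂, c, g₁, g₂, g₃, rfl, g₅, h0, hafter⟩ :=
    hs.split_last (P := fun x => ∀ y ∈ L₂, ¬ A y x) ⟨s, hp.mem_iff.2 hsL, hsdom⟩
      (fun h => h w' hww.right_mem hw'u)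
  have hx01 : OpenedAt A part L₁ N₁ x₀ x₁ c := OpenedAt.of_split g₁ g₂ g₃ hl (by omega) hp
  have hc := le_one g₂
  cases g₃ with
  | single =>
    have hww' := hww
    obtain ⟨m, k, ht, hm, hk, hq⟩ := hww'
    cases ht with
    | single => exact hA.noInside _ _ rfl hAw
    | @cons _ w'' _ m e k hlink ht =>
      have he := le_one hlink
      have hw2 : OpenedAt A part L₂ N₂ w' w'' e :=
        OpenedAt.of_split (Seg.single w') hlink ht hm (by omega) hq
      obtain ⟨hp2, -, hA2⟩ := enter hx01 h0 hw2 hw'u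
      have hA3 := leave hx01 h0 hw2 hw'u
      have hA4 : A x₀ w' := by
        refine (hA.adj _ _ fun h => hA.noInside _ _ ?_ hA2).resolve_right
          (h0 _ hww.right_mem)
        exact h.symm.trans hp2.symm
      have := hno _ _ _ _ _ (g₁.append (arc hA4) ((Seg.single w').append (arc hw'u)
        ((Seg.single u).append (arc hA3) ht))) (Or.inr ⟨rfl, hwu.trans huu⟩) (by
          refine List.Perm.trans ?_ (hp.append hq)
          simp only [List.append_assoc]
          refine List.Perm.append_left _ ?_
          exact List.Perm.swap _ _ _)
      omega
  | @cons _ x₂ _ l₂ c' n₂ hlink g₃ =>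
    obtain ⟨t, ht2⟩ := g₃.eq_cons
    have hc' := le_one hlink
    have hx12 : OpenedAt A part L₁ N₁ x₁ x₂ c' :=
      OpenedAt.of_split (g₁.append g₂ (Seg.single x₁)) hlink g₃ hl (by omega) (by simpa using hp)
    have h2 := hafter x₂ (by simp [ht2])
    have h1 := hafter x₁ (by simp)
    push Not at h1 h2
    obtain ⟨y, hy, hyx⟩ := h2
    obtain ⟨z, hz, hzx⟩ := h1
    obtain ⟨y', d', hyy⟩ := h₂ y hy
    have hd' := le_one (link_of hyy)
    have hx01A : A x₀ x₁ := by
      obtain ⟨z', e, hzz⟩ := h₂ z hz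
      exact (enter hx01 h0 hzz hzx).2.1
    have hnot : ¬ A x₁ y' := fun h => by
      have := merge hx12 hyy (arc h) (arc hyx)
      omega
    have hpy : part y' ≠ part x₀ := by
      intro h
      refine not_enter hx01 h0 hyy.right_mem h ?_
      exact (hA.adj x₁ y' fun h' => hA.noInside _ _ (h.symm.trans h'.symm) hx01A).resolve_left
        hnot
    have hx0y : A x₀ y' := (hA.adj _ _ hpy).resolve_left (h0 _ hyy.right_mem)
    have hzy : z ≠ y := by
      rintro rfl
      exact hpy (enter hx01 h0 hyy hzx).1
    obtain ⟨m, k, ht, hm, hk, hq⟩ := hyy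
    obtain ⟨z', m₁, m₂, k₁, k₂, e, q₁, q₂, q₃, rfl, q₅⟩ :=
      ht.split_of_mem (hq.mem_iff.2 hz) hzy
    have he := le_one q₂
    have hzz : OpenedAt A part L₂ N₂ z z' e := OpenedAt.of_split q₁ q₂ q₃ hm (by omega) hq
    have := hno _ _ _ _ _ (((g₃.append hl g₁).append (arc hx0y) q₁).append (arc hzx)
      ((Seg.single x₁).append (arc (leave hx01 h0 hzz hzx)) q₃)) (arc hyx) (by
        refine List.Perm.trans ?_ (hp.append hq)
        rw [List.perm_iff_count]
        intro a
        simp only [List.count_append, List.count_cons, List.count_nil]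
        omega)
    omega

/-- Suppose `C₁ ≃> C₂` are disjoint G-cycles and there is no G-cycle on
`V(C₁) ∪ V(C₂)` with at least `ℓ(C₁) + ℓ(C₂)` arcs.  If one of the two G-cycles has a
pair of consecutive vertices `u, u⁺` from the same partite set `V`, then the other
G-cycle contains no vertex from `V`. -/
theorem stmt15 {V K : Type} {A : V → V → Prop} {part : V → K}
    (hSMD : IsSMD A part) (C₁ C₂ : GCycle A part)
    (hdisj : ∀ x ∈ C₁.toGPath.verts, x ∉ C₂.toGPath.verts)
    (hsim : SimGt C₁ C₂)
    (hno : ¬ ∃ C : GCycle A part,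
      (∀ v : V, v ∈ C.toGPath.verts ↔ v ∈ C₁.toGPath.verts ∨ v ∈ C₂.toGPath.verts) ∧
      C₁.len + C₂.len ≤ C.len) :
    ∀ u u' : V,
      (C₁.consec u u' → part u = part u' → ∀ w ∈ C₂.toGPath.verts, part w ≠ part u) ∧
      (C₂.consec u u' → part u = part u' → ∀ w ∈ C₁.toGPath.verts, part w ≠ part u) := by
  obtain ⟨⟨s, hs, hss⟩, hout, ⟨t, ht, hts⟩, hin⟩ := hsim
  obtain ⟨v₁, hv₁⟩ := C₁.exists_openedAt hSMD
  obtain ⟨v₂, hv₂⟩ := C₂.exists_openedAt hSMD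
  have hno' : ∀ a b l n w, Seg A part a b l n → Link A part b a w →
      l.Perm (C₁.verts ++ C₂.verts) → n + w < C₁.len + C₂.len := by
    intro a b l n w hsg hl hp
    by_contra! hle
    have hnd : (C₁.verts ++ C₂.verts).Nodup :=
      List.Nodup.append C₁.nodup C₂.nodup fun x hx hx' => hdisj x hx hx'
    obtain ⟨C, hC, hlen⟩ := GCycle.exists_of_seg hSMD hsg hl (hp.nodup_iff.2 hnd)
    refine hno ⟨C, fun v => ?_, hlen ▸ hle⟩
    rw [hC, hp.mem_iff, List.mem_append]
  have weight_zero : ∀ {L : List V} {N : ℕ} {x y : V} {w : ℕ}, OpenedAt A part L N x y w →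
      part x = part y → OpenedAt A part L N x y 0 := by
    rintro L N x y w ⟨l, n, h₁, h₂, h₃⟩ h
    have hw := h₂.weight_eq hSMD
    rw [if_neg (hSMD.noInside _ _ h)] at hw
    subst hw
    exact ⟨l, n, h₁, h₂, h₃⟩
  intro u u'
  refine ⟨fun hc hp => ?_, fun hc hp => ?_⟩
  · obtain ⟨w, hw⟩ := C₁.openedAt_of_consec hSMD hc
    exact part_ne_of_no_merge hSMD (weight_zero hw hp) (fun y hy => hv₂.exists_of_mem hy) hno'
      ⟨s, hs, fun y hy => (hout s hs hss y hy).2⟩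
  · obtain ⟨w, hw⟩ := C₂.openedAt_of_consec hSMD hc
    rw [hp]
    refine part_ne_of_no_merge hSMD.reverse (weight_zero hw hp).reverse
      (fun y hy => hv₁.reverse.exists_of_mem hy) ?_
      ⟨t, ht, fun y hy => (hin t ht hts y hy).2⟩
    intro a b l n w hsg hl hperm
    rw [add_comm C₂.len]
    exact hno' b a _ n w hsg.reverse hl.reverse
      (l.reverse_perm.trans (hperm.trans List.perm_append_comm))
end
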